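/- Suppose B̂₀ > 0 and let ν be a quantum limit for 𝓛_α. If k ∈ ℤ² \ {0} is such that the Fourier coefficient ν̂_k := ∫_{𝕋²} e^{−2iπ k·x} dν(x) is nonzero, then there exist x₀ ∈ 𝕋² and θ ∈ S¹ with k·θ = 0 such that B_∞(x₀,θ) = 0. -/

import Mathlib

open MeasureTheory Filter Topology
open scoped Real ENNReal

noncomputable section

abbrev Pt : Type := ℝ × ℝ

/-- `v ∧ w = v₁w₂ - v₂w₁`. -/
def wedge (v w : Pt) : ℝ := v.1 * w.2 - v.2 * w.1

/-- Euclidean dot product on `ℝ²`. -/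
def dotp (v w : Pt) : ℝ := v.1 * w.1 + v.2 * w.2

/-- The fundamental domain `[0,1]²` of the torus `𝕋² = ℝ²/ℤ²`. -/
def fund : Set Pt := Set.Icc (0, 0) (1, 1)

/-- `ℤ²`-periodicity of a function on `ℝ²`. -/
def IsPeriodic {E : Type*} (f : Pt → E) : Prop :=
  ∀ (m : ℤ × ℤ) (x : Pt), f (x.1 + m.1, x.2 + m.2) = f x

/-- The magnetic translation `𝒯_m^B` associated to the flux `B0 = B̂₀`. -/
def magTrans (B0 : ℝ) (m : ℤ × ℤ) (u : Pt → ℂ) : Pt → ℂ := fun x =>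
  Complex.exp (Complex.I * (B0 / 2) * (wedge ((m.1 : ℝ), (m.2 : ℝ)) x : ℝ)) *
    u (x.1 - m.1, x.2 - m.2)

/-- First partial derivative of a complex valued function on `ℝ²`. -/
def pd1 (u : Pt → ℂ) : Pt → ℂ := fun x => fderiv ℝ u x (1, 0)

/-- Second partial derivative of a complex valued function on `ℝ²`. -/
def pd2 (u : Pt → ℂ) : Pt → ℂ := fun x => fderiv ℝ u x (0, 1)

/-- First partial derivative of a real valued function on `ℝ²`. -/
def pdR1 (f : Pt → ℝ) : Pt → ℝ := fun x => fderiv ℝ f x (1, 0)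

/-- Second partial derivative of a real valued function on `ℝ²`. -/
def pdR2 (f : Pt → ℝ) : Pt → ℝ := fun x => fderiv ℝ f x (0, 1)

/-- The vector potential `A⁰(x₁,x₂) = (B̂₀/2)(−x₂, x₁)`. -/
def A0 (B0 : ℝ) : Pt → Pt := fun x => (B0 / 2 * (-x.2), B0 / 2 * x.1)

/-- `(-i∂₁ - α₁ - A₁) u`. -/
def Dop1 (α : Pt) (A : Pt → Pt) (u : Pt → ℂ) : Pt → ℂ := fun x =>
  -Complex.I * pd1 u x - ((α.1 + (A x).1 : ℝ) : ℂ) * u x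

/-- `(-i∂₂ - α₂ - A₂) u`. -/
def Dop2 (α : Pt) (A : Pt → Pt) (u : Pt → ℂ) : Pt → ℂ := fun x =>
  -Complex.I * pd2 u x - ((α.2 + (A x).2 : ℝ) : ℂ) * u x

/-- The magnetic Laplacian `𝓛_α u = (−i∂₁−α₁−A₁)²u + (−i∂₂−α₂−A₂)²u`. -/
def magLap (α : Pt) (A : Pt → Pt) (u : Pt → ℂ) : Pt → ℂ := fun x =>
  Dop1 α A (Dop1 α A u) x + Dop2 α A (Dop2 α A u) x

/-- Membership in `C^∞(𝕋²,L)`: smooth and invariant under all magnetic translations. -/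
def MemCL (B0 : ℝ) (u : Pt → ℂ) : Prop :=
  ContDiff ℝ (⊤ : ℕ∞) u ∧ ∀ m : ℤ × ℤ, magTrans B0 m u = u

end

/-- The torus `𝕋² = ℝ²/ℤ²`. -/
abbrev T2 : Type := UnitAddCircle × UnitAddCircle

/-- The canonical projection `ℝ² → 𝕋²`. -/
noncomputable def proj2 (x : Pt) : T2 := ((x.1 : UnitAddCircle), (x.2 : UnitAddCircle))

/-- `ν` is a quantum limit for `𝓛_α`: a probability measure on `𝕋²` which is the weak-⋆
limit of the position densities `|u_n|²dx` of a normalized sequence of `o(h_n^{3/2})`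
quasimodes of `h_n²𝓛_α`. -/
def IsQuantumLimit (B0 : ℝ) (α : Pt) (A : Pt → Pt) (ν : MeasureTheory.Measure T2) : Prop :=
  MeasureTheory.IsProbabilityMeasure ν ∧
  ∃ (h : ℕ → ℝ) (u : ℕ → Pt → ℂ),
    (∀ n, 0 < h n) ∧ Tendsto h atTop (𝓝 0) ∧
    (∀ n, ContDiff ℝ 2 (u n)) ∧ (∀ n (m : ℤ × ℤ), magTrans B0 m (u n) = u n) ∧
    (∀ n, ∫ x in fund, ‖u n x‖ ^ 2 = 1) ∧
    ((fun n => (∫ x in fund,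
        ‖((h n ^ 2 : ℝ) : ℂ) * magLap α A (u n) x - u n x‖ ^ 2) ^ ((1 : ℝ) / 2))
      =o[atTop] fun n => h n ^ ((3 : ℝ) / 2)) ∧
    (∀ f : T2 → ℂ, Continuous f →
      Tendsto (fun n => ∫ x in fund, f (proj2 x) * ((‖u n x‖ ^ 2 : ℝ) : ℂ)) atTop
        (𝓝 (∫ p, f p ∂ν)))

open scoped ComplexConjugate

section ParametricIntegrals

variable {E : Type} [NormedAddCommGroup E] [NormedSpace ℝ E]

theorem hasFDerivAt_integral_of_contDiff {F : Pt × ℝ → E} (hF : ContDiff ℝ 1 F) (a b : ℝ)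
    (x : Pt) :
    HasFDerivAt (fun x => ∫ t in a..b, F (x, t))
      (∫ t in a..b, (fderiv ℝ F (x, t)).comp (ContinuousLinearMap.inl ℝ Pt ℝ)) x := by
  have hc : Continuous fun p : Pt × ℝ =>
      (fderiv ℝ F p).comp (ContinuousLinearMap.inl ℝ Pt ℝ) :=
    (hF.continuous_fderiv one_ne_zero).clm_comp continuous_const
  obtain ⟨M, hM⟩ := ((isCompact_closedBall x 1).prod (isCompact_uIcc (a := a) (b := b))
    ).exists_bound_of_continuousOn hc.continuousOn
  refine intervalIntegral.hasFDerivAt_integral_of_dominated_of_fderiv_le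
    (F' := fun x t => (fderiv ℝ F (x, t)).comp (ContinuousLinearMap.inl ℝ Pt ℝ))
    (bound := fun _ => M) (Metric.closedBall_mem_nhds x one_pos) ?_ ?_ ?_ ?_ ?_ ?_
  · have := hF.continuous
    exact Eventually.of_forall fun y =>
      (by fun_prop : Continuous fun t => F (y, t)).aestronglyMeasurable
  · have := hF.continuous
    exact (by fun_prop : Continuous fun t => F (x, t)).intervalIntegrable _ _
  · exact (hc.comp (by fun_prop : Continuous fun t : ℝ => (x, t))).aestronglyMeasurable
  · exact Eventually.of_forall fun t ht y hy => hM (y, t) ⟨hy, Set.uIoc_subset_uIcc ht⟩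
  · exact intervalIntegrable_const
  · refine Eventually.of_forall fun t _ y _ => ?_
    have h1 : HasFDerivAt F (fderiv ℝ F (y, t)) (y, t) :=
      (hF.differentiable one_ne_zero _).hasFDerivAt
    exact h1.comp y (hasFDerivAt_prodMk_left y t)

theorem contDiff_integral_of_contDiff (n : ℕ) {E : Type} [NormedAddCommGroup E]
    [NormedSpace ℝ E] {F : Pt × ℝ → E} (hF : ContDiff ℝ n F) (a b : ℝ) :
    ContDiff ℝ n (fun x => ∫ t in a..b, F (x, t)) := by
  induction n generalizing E with
  | zero =>
    have := hF.continuous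
    exact contDiff_zero.2 (intervalIntegral.continuous_parametric_intervalIntegral_of_continuous'
      (f := fun x t => F (x, t)) this a b)
  | succ n ih =>
    have h1 : ContDiff ℝ 1 F := hF.of_le (by norm_cast; omega)
    push_cast at hF ⊢
    rw [contDiff_succ_iff_fderiv] at hF ⊢
    refine ⟨fun x => (hasFDerivAt_integral_of_contDiff h1 a b x).differentiableAt, by simp, ?_⟩
    have : fderiv ℝ (fun x => ∫ t in a..b, F (x, t)) = fun x =>
        ∫ t in a..b, (fderiv ℝ F (x, t)).comp (ContinuousLinearMap.inl ℝ Pt ℝ) :=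
      funext fun x => (hasFDerivAt_integral_of_contDiff h1 a b x).fderiv
    rw [this]
    exact ih (hF.2.2.clm_comp contDiff_const)

/-- Weighted integral of `G` along the segment `x + t v`, `a ≤ t ≤ b`. -/
noncomputable def rayIntegral (ψ : ℝ → ℝ) (G : Pt → ℝ) (v : Pt) (a b : ℝ) (x : Pt) : ℝ :=
  ∫ t in a..b, ψ t * G (x + t • v)

theorem ContDiff.rayIntegral {n : ℕ} {ψ : ℝ → ℝ} {G : Pt → ℝ} (hψ : ContDiff ℝ n ψ)
    (hG : ContDiff ℝ n G) (v : Pt) (a b : ℝ) : ContDiff ℝ n (rayIntegral ψ G v a b) :=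
  contDiff_integral_of_contDiff n (F := fun p : Pt × ℝ => ψ p.2 * G (p.1 + p.2 • v))
    ((hψ.comp contDiff_snd).mul (hG.comp (by fun_prop))) a b

theorem fderiv_rayIntegral {ψ : ℝ → ℝ} {G : Pt → ℝ} (hψ : ContDiff ℝ 1 ψ)
    (hG : ContDiff ℝ 1 G) (v : Pt) (a b : ℝ) (x w : Pt) :
    fderiv ℝ (rayIntegral ψ G v a b) x w =
      rayIntegral ψ (fun y => fderiv ℝ G y w) v a b x := by
  have hF : ContDiff ℝ 1 fun p : Pt × ℝ => ψ p.2 * G (p.1 + p.2 • v) :=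
    (hψ.comp contDiff_snd).mul (hG.comp (by fun_prop))
  have hc : Continuous fun t : ℝ => (fderiv ℝ (fun p : Pt × ℝ => ψ p.2 * G (p.1 + p.2 • v))
      (x, t)).comp (ContinuousLinearMap.inl ℝ Pt ℝ) :=
    ((hF.continuous_fderiv one_ne_zero).comp (by fun_prop)).clm_comp continuous_const
  have h := (hasFDerivAt_integral_of_contDiff hF a b x).fderiv
  have h' : fderiv ℝ (rayIntegral ψ G v a b) x w = (∫ t in a..b,
      (fderiv ℝ (fun p : Pt × ℝ => ψ p.2 * G (p.1 + p.2 • v)) (x, t)).comp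
        (ContinuousLinearMap.inl ℝ Pt ℝ)) w := by rw [← h]; rfl
  rw [h', ContinuousLinearMap.intervalIntegral_apply (hc.intervalIntegrable a b)]
  refine intervalIntegral.integral_congr fun t _ => ?_
  have h1 : HasFDerivAt (fun p : Pt × ℝ => ψ p.2 * G (p.1 + p.2 • v))
      (fderiv ℝ (fun p : Pt × ℝ => ψ p.2 * G (p.1 + p.2 • v)) (x, t)) (x, t) :=
    (hF.differentiable one_ne_zero _).hasFDerivAt
  have h2 := (h1.comp x (hasFDerivAt_prodMk_left (𝕜 := ℝ) x t)).fderiv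
  have h3 : HasFDerivAt (fun y : Pt => ψ t * G (y + t • v)) (ψ t • fderiv ℝ G (x + t • v)) x := by
    have := (hG.differentiable one_ne_zero (x + t • v)).hasFDerivAt.comp x
      ((hasFDerivAt_id x).add_const (t • v))
    simpa using this.const_mul (ψ t)
  have h4 : (fderiv ℝ (fun p : Pt × ℝ => ψ p.2 * G (p.1 + p.2 • v)) (x, t)).comp
      (ContinuousLinearMap.inl ℝ Pt ℝ) = ψ t • fderiv ℝ G (x + t • v) := by
    rw [← h2, ← h3.fderiv]; rfl
  simp only [h4]
  simp

theorem continuous_rayIntegral {ψ : ℝ → ℝ} {G : Pt → ℝ} (hψ : Continuous ψ) (hG : Continuous G)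
    (v : Pt) (a : ℝ) : Continuous fun p : ℝ × Pt => rayIntegral ψ G v a p.1 p.2 := by
  unfold rayIntegral
  have : Continuous (fun p : (ℝ × Pt) × ℝ => ψ p.2 * G (p.1.2 + p.2 • v)) := by fun_prop
  exact intervalIntegral.continuous_parametric_intervalIntegral_of_continuous
    (f := fun (p : ℝ × Pt) t => ψ t * G (p.2 + t • v)) this continuous_fst

theorem hasDerivAt_comp_ray {E : Type} [NormedAddCommGroup E] [NormedSpace ℝ E] {G : Pt → E}
    (hG : ContDiff ℝ 1 G) (x v : Pt) (t : ℝ) :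
    HasDerivAt (fun t : ℝ => G (x + t • v)) (fderiv ℝ G (x + t • v) v) t := by
  have h := (hG.differentiable one_ne_zero (x + t • v)).hasFDerivAt.comp_hasDerivAt t
    (((hasDerivAt_id t).smul_const v).const_add x)
  rw [one_smul] at h
  exact h

theorem integral_fderiv_ray {G : Pt → ℝ} (hG : ContDiff ℝ 1 G) (x v : Pt) (a b : ℝ) :
    ∫ t in a..b, fderiv ℝ G (x + t • v) v = G (x + b • v) - G (x + a • v) := by
  refine intervalIntegral.integral_eq_sub_of_hasDerivAt
    (fun t _ => hasDerivAt_comp_ray hG x v t) (Continuous.intervalIntegrable ?_ _ _)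
  exact ((hG.continuous_fderiv one_ne_zero).comp (by fun_prop)).clm_apply continuous_const

end ParametricIntegrals

/-! ### Integration over the fundamental domain -/

/-- The vector of `ℝ²` with integer coordinates `m`. -/
def intVec (m : ℤ × ℤ) : Pt := (m.1, m.2)

theorem IsPeriodic.add_intVec {E : Type*} {f : Pt → E} (hf : IsPeriodic f) (m : ℤ × ℤ) (x : Pt) :
    f (x + intVec m) = f x := hf m x

theorem isCompact_fund : IsCompact fund := isCompact_Icc

theorem measurableSet_fund : MeasurableSet fund := measurableSet_Icc

theorem Continuous.integrableOn_fund {E : Type*} [NormedAddCommGroup E] {f : Pt → E}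
    (hf : Continuous f) : IntegrableOn f fund := hf.continuousOn.integrableOn_compact isCompact_fund

section Fund

variable {E : Type*} [NormedAddCommGroup E] [NormedSpace ℝ E]

theorem setIntegral_fund_eq {f : Pt → E} (hf : Continuous f) :
    ∫ x in fund, f x = ∫ s in (0 : ℝ)..1, ∫ t in (0 : ℝ)..1, f (s, t) := by
  have h : fund = Set.Icc (0 : ℝ) 1 ×ˢ Set.Icc (0 : ℝ) 1 := by
    rw [fund, Set.Icc_prod_Icc]
  have hi := hf.integrableOn_fund
  rw [h] at hi ⊢
  rw [Measure.volume_eq_prod] at hi ⊢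
  rw [setIntegral_prod _ hi]
  simp_rw [intervalIntegral.integral_of_le zero_le_one, integral_Icc_eq_integral_Ioc]

theorem setIntegral_fund_add {f : Pt → E} (hf : Continuous f) (hp : IsPeriodic f) (v : Pt) :
    ∫ x in fund, f (x + v) = ∫ x in fund, f x := by
  rw [setIntegral_fund_eq hf, setIntegral_fund_eq (by fun_prop)]
  have h2 : ∀ s : ℝ, Function.Periodic (fun t => f (s, t)) 1 := fun s t => by
    simpa using hp (0, 1) (s, t)
  have h1 : Function.Periodic (fun s : ℝ => ∫ t in (0 : ℝ)..1, f (s, t)) 1 := fun s => by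
    refine intervalIntegral.integral_congr fun t _ => ?_
    simpa using hp (1, 0) (s, t)
  calc ∫ s in (0 : ℝ)..1, ∫ t in (0 : ℝ)..1, f ((s, t) + v)
      = ∫ s in (0 : ℝ)..1, (fun s : ℝ => ∫ t in (0 : ℝ)..1, f (s, t)) (s + v.1) := by
        refine intervalIntegral.integral_congr fun s _ => ?_
        have := intervalIntegral.integral_comp_add_right (a := 0) (b := 1)
          (fun t => f (s + v.1, t)) v.2
        have h3 := (h2 (s + v.1)).intervalIntegral_add_eq v.2 0
        simp only [zero_add] at this h3
        rw [add_comm v.2 1] at h3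
        exact this.trans h3
    _ = _ := by
        rw [intervalIntegral.integral_comp_add_right
          (fun s : ℝ => ∫ t in (0 : ℝ)..1, f (s, t)) v.1]
        have := h1.intervalIntegral_add_eq v.1 0
        rw [zero_add, add_comm 1 v.1]
        rw [zero_add] at this
        exact this

theorem integral_setIntegral_fund_swap {F : ℝ → Pt → E}
    (hF : Continuous fun p : ℝ × Pt => F p.1 p.2) (a b : ℝ) :
    ∫ s in a..b, ∫ x in fund, F s x = ∫ x in fund, ∫ s in a..b, F s x := by
  refine intervalIntegral_integral_swap ?_
  rw [Measure.prod_restrict]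
  exact (hF.continuousOn.integrableOn_compact
    (isCompact_uIcc.prod isCompact_fund)).mono_set
    (Set.prod_mono Set.uIoc_subset_uIcc le_rfl)

theorem continuous_setIntegral_fund {F : ℝ → Pt → E}
    (hF : Continuous fun p : ℝ × Pt => F p.1 p.2) : Continuous fun s => ∫ x in fund, F s x :=
  continuous_parametric_integral_of_continuous (f := F) hF isCompact_fund

end Fund

theorem IsPeriodic.fderiv {E : Type*} [NormedAddCommGroup E] [NormedSpace ℝ E] {f : Pt → E}
    (hp : IsPeriodic f) : IsPeriodic (fderiv ℝ f) := fun m x => by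
  have h : (fun y => f (y + intVec m)) = f := funext fun y => hp m y
  have := fderiv_comp_add_right (𝕜 := ℝ) (f := f) (x := x) (intVec m)
  rw [h] at this
  exact this.symm

theorem setIntegral_fund_fderiv {f : Pt → ℂ} (hf : ContDiff ℝ 1 f) (hp : IsPeriodic f) (v : Pt) :
    ∫ x in fund, fderiv ℝ f x v = 0 := by
  have hc : Continuous fun y => fderiv ℝ f y v :=
    (hf.continuous_fderiv one_ne_zero).clm_apply continuous_const
  have hpv : IsPeriodic fun y => fderiv ℝ f y v := fun m x => by
    simp only [hp.fderiv m x]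
  have h1 : ∀ x : Pt, ∫ t in (0 : ℝ)..1, fderiv ℝ f (x + t • v) v = f (x + v) - f x := fun x => by
    have := intervalIntegral.integral_eq_sub_of_hasDerivAt (a := 0) (b := 1)
      (fun t _ => hasDerivAt_comp_ray hf x v t)
      (Continuous.intervalIntegrable (hc.comp (by fun_prop)) _ _)
    simpa using this
  have h2 := integral_setIntegral_fund_swap (F := fun t x => fderiv ℝ f (x + t • v) v)
    (hc.comp (by fun_prop : Continuous fun p : ℝ × Pt => p.2 + p.1 • v)) 0 1
  simp_rw [h1, setIntegral_fund_add hc hpv] at h2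
  have hfc := hf.continuous
  rw [integral_sub (Continuous.integrableOn_fund (by fun_prop)) hfc.integrableOn_fund,
    setIntegral_fund_add hfc hp, sub_self] at h2
  simpa using h2

theorem IsPeriodic.exists_bound {E : Type*} [NormedAddCommGroup E] {f : Pt → E}
    (hp : IsPeriodic f) (hf : Continuous f) : ∃ M, 0 ≤ M ∧ ∀ x, ‖f x‖ ≤ M := by
  obtain ⟨M, hM⟩ := isCompact_fund.exists_bound_of_continuousOn hf.continuousOn
  refine ⟨max M 0, le_max_right _ _, fun x => ?_⟩
  have h := hp (-⌊x.1⌋, -⌊x.2⌋) x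
  rw [← h]
  refine (hM _ ?_).trans (le_max_left _ _)
  simp only [fund, Set.mem_Icc, Prod.mk_le_mk, Int.cast_neg]
  have := Int.floor_le x.1; have := Int.floor_le x.2
  have := Int.lt_floor_add_one x.1; have := Int.lt_floor_add_one x.2
  refine ⟨⟨?_, ?_⟩, ?_, ?_⟩ <;> linarith

/-! ### The `L²` pairing over the fundamental domain -/

/-- The `L²([0,1]²)` inner product, linear in the first argument. -/
noncomputable def ip (f g : Pt → ℂ) : ℂ := ∫ x in fund, f x * conj (g x)

/-- The `L²([0,1]²)` norm. -/
noncomputable def nrm (f : Pt → ℂ) : ℝ := √(∫ x in fund, ‖f x‖ ^ 2)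

theorem nrm_nonneg (f : Pt → ℂ) : 0 ≤ nrm f := Real.sqrt_nonneg _

theorem nrm_sq (f : Pt → ℂ) : nrm f ^ 2 = ∫ x in fund, ‖f x‖ ^ 2 :=
  Real.sq_sqrt (integral_nonneg fun _ => by positivity)

theorem ip_self (f : Pt → ℂ) : ip f f = ((nrm f ^ 2 : ℝ) : ℂ) := by
  rw [nrm_sq, ip, ← integral_complex_ofReal]
  refine integral_congr_ae (Eventually.of_forall fun x => ?_)
  simp [Complex.mul_conj, Complex.normSq_eq_norm_sq]

theorem ip_add_left {f₁ f₂ g : Pt → ℂ} (h₁ : Continuous f₁) (h₂ : Continuous f₂)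
    (hg : Continuous g) : ip (fun x => f₁ x + f₂ x) g = ip f₁ g + ip f₂ g := by
  unfold ip
  rw [← integral_add (Continuous.integrableOn_fund (by fun_prop))
    (Continuous.integrableOn_fund (by fun_prop))]
  simp_rw [add_mul]

theorem ip_sub_left {f₁ f₂ g : Pt → ℂ} (h₁ : Continuous f₁) (h₂ : Continuous f₂)
    (hg : Continuous g) : ip (fun x => f₁ x - f₂ x) g = ip f₁ g - ip f₂ g := by
  unfold ip
  rw [← integral_sub (Continuous.integrableOn_fund (by fun_prop))
    (Continuous.integrableOn_fund (by fun_prop))]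
  simp_rw [sub_mul]

theorem ip_const_mul_left (c : ℂ) (f g : Pt → ℂ) :
    ip (fun x => c * f x) g = c * ip f g := by
  unfold ip
  rw [← integral_const_mul]
  simp_rw [mul_assoc]

theorem conj_ip (f g : Pt → ℂ) : conj (ip f g) = ip g f := by
  unfold ip
  rw [← integral_conj]
  simp [mul_comm]

theorem ip_add_right {f g₁ g₂ : Pt → ℂ} (hf : Continuous f) (h₁ : Continuous g₁)
    (h₂ : Continuous g₂) : ip f (fun x => g₁ x + g₂ x) = ip f g₁ + ip f g₂ := by
  rw [← conj_ip, ip_add_left h₁ h₂ hf, map_add, conj_ip, conj_ip]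

theorem ip_sub_right {f g₁ g₂ : Pt → ℂ} (hf : Continuous f) (h₁ : Continuous g₁)
    (h₂ : Continuous g₂) : ip f (fun x => g₁ x - g₂ x) = ip f g₁ - ip f g₂ := by
  rw [← conj_ip, ip_sub_left h₁ h₂ hf, map_sub, conj_ip, conj_ip]

theorem ip_const_mul_right (c : ℂ) (f g : Pt → ℂ) :
    ip f (fun x => c * g x) = conj c * ip f g := by
  rw [← conj_ip, ip_const_mul_left, map_mul, conj_ip]

theorem norm_ip_le {f g : Pt → ℂ} (hf : Continuous f) (hg : Continuous g) :
    ‖ip f g‖ ≤ nrm f * nrm g := by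
  have h2 : ∀ {u : Pt → ℂ}, Continuous u →
      MemLp (fun x => ‖u x‖) (ENNReal.ofReal 2) (volume.restrict fund) := fun {u} hu => by
    have : IsFiniteMeasure (volume.restrict fund) := ⟨by
      simpa using isCompact_fund.measure_lt_top⟩
    obtain ⟨M, hM⟩ := isCompact_fund.exists_bound_of_continuousOn hu.continuousOn
    refine MemLp.of_bound hu.norm.aestronglyMeasurable M ?_
    filter_upwards [ae_restrict_mem measurableSet_fund] with x hx
    simpa using hM x hx
  have key := integral_mul_le_Lp_mul_Lq_of_nonneg (μ := volume.restrict fund)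
    (p := 2) (q := 2) Real.HolderConjugate.two_two (f := fun x => ‖f x‖) (g := fun x => ‖g x‖)
    (Eventually.of_forall fun _ => norm_nonneg _) (Eventually.of_forall fun _ => norm_nonneg _)
    (h2 hf) (h2 hg)
  refine (norm_integral_le_integral_norm _).trans ?_
  simp only [norm_mul, RCLike.norm_conj]
  refine key.trans (le_of_eq ?_)
  simp only [nrm, Real.sqrt_eq_rpow]
  norm_cast

theorem nrm_mul_le {a f : Pt → ℂ} {M : ℝ} (hM : 0 ≤ M) (ha : Continuous a) (hf : Continuous f)
    (haM : ∀ x, ‖a x‖ ≤ M) : nrm (fun x => a x * f x) ≤ M * nrm f := by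
  refine Real.sqrt_le_iff.2 ⟨mul_nonneg hM (nrm_nonneg f), ?_⟩
  rw [mul_pow, nrm_sq, ← integral_const_mul]
  refine integral_mono (Continuous.integrableOn_fund (by fun_prop))
    (Continuous.integrableOn_fund (by fun_prop)) fun x => ?_
  simp only [norm_mul, mul_pow]
  gcongr
  exact haM x

/-! ### Magnetic potentials and covariant derivatives -/

/-- A smooth vector potential `P` on `ℝ²` with periodic field `B`, whose translates by integer
vectors differ from it by the linear potential of flux `Φ`. -/
structure IsMagneticPotential (Φ : ℝ) (P : Pt → Pt) (B : Pt → ℝ) : Prop where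
  smooth_pot : ContDiff ℝ (⊤ : ℕ∞) P
  smooth_field : ContDiff ℝ (⊤ : ℕ∞) B
  periodic : IsPeriodic B
  pot_add : ∀ (m : ℤ × ℤ) (x : Pt), P (x + intVec m) = P x + A0 Φ (intVec m)
  curl : ∀ x v w : Pt,
    dotp w (fderiv ℝ P x v) - dotp v (fderiv ℝ P x w) = wedge v w * B x

/-- Equivariance under the magnetic translations of flux `Φ`. -/
def Equivariant (Φ : ℝ) (f : Pt → ℂ) : Prop :=
  ∀ (m : ℤ × ℤ) (x : Pt),
    f (x + intVec m) = Complex.exp (Complex.I * (Φ / 2 * wedge (intVec m) x : ℝ)) * f x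

/-- The covariant derivative `-i∂_v - v·P`. -/
noncomputable def covD (P : Pt → Pt) (v : Pt) (f : Pt → ℂ) : Pt → ℂ := fun x =>
  -Complex.I * fderiv ℝ f x v - (dotp v (P x) : ℂ) * f x

/-- Parallel transport `e^{is(-i∂_v - v·P)}` along `v`. -/
noncomputable def transport (P : Pt → Pt) (v : Pt) (s : ℝ) (f : Pt → ℂ) : Pt → ℂ := fun x =>
  Complex.exp (-Complex.I * (rayIntegral 1 (fun y => dotp v (P y)) v 0 s x : ℝ)) * f (x + s • v)

/-- The magnetic flux through the strip swept by `w` along the segment `[x, x + s v]`. -/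
noncomputable def twist (B : Pt → ℝ) (v w : Pt) (s : ℝ) (x : Pt) : ℝ :=
  wedge v w * rayIntegral 1 B v 0 s x

theorem norm_exp_neg_I_mul (r : ℝ) : ‖Complex.exp (-Complex.I * r)‖ = 1 := by
  have : -Complex.I * r = ((-r : ℝ) : ℂ) * Complex.I := by push_cast; ring
  rw [this, Complex.norm_exp_ofReal_mul_I]

theorem norm_exp_I_mul (r : ℝ) : ‖Complex.exp (Complex.I * r)‖ = 1 := by
  rw [mul_comm, Complex.norm_exp_ofReal_mul_I]

theorem exp_I_mul_conj (r : ℝ) :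
    Complex.exp (Complex.I * r) * conj (Complex.exp (Complex.I * r)) = 1 := by
  rw [Complex.mul_conj, Complex.normSq_eq_norm_sq, norm_exp_I_mul]; simp

theorem dotp_comp_contDiff {n : WithTop ℕ∞} {P : Pt → Pt} (hP : ContDiff ℝ n P) (v : Pt) :
    ContDiff ℝ n fun y => dotp v (P y) := by
  unfold dotp
  exact (contDiff_const.mul hP.fst).add (contDiff_const.mul hP.snd)

theorem fderiv_dotp_comp {P : Pt → Pt} {x : Pt} (hP : DifferentiableAt ℝ P x) (v w : Pt) :
    fderiv ℝ (fun y => dotp v (P y)) x w = dotp v (fderiv ℝ P x w) := by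
  unfold dotp
  have h1 := (hP.hasFDerivAt.fst.const_mul v.1).add (hP.hasFDerivAt.snd.const_mul v.2)
  erw [h1.fderiv]
  simp

section Covariant

variable {Φ : ℝ} {P : Pt → Pt} {B : Pt → ℝ}

theorem IsMagneticPotential.contDiff (hP : IsMagneticPotential Φ P B) (n : ℕ) :
    ContDiff ℝ n P := hP.smooth_pot.of_le (by exact_mod_cast le_top)

theorem IsMagneticPotential.contDiff_field (hP : IsMagneticPotential Φ P B) (n : ℕ) :
    ContDiff ℝ n B := hP.smooth_field.of_le (by exact_mod_cast le_top)

theorem Equivariant.isPeriodic_mul_conj {f g : Pt → ℂ} (hf : Equivariant Φ f)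
    (hg : Equivariant Φ g) : IsPeriodic fun x => f x * conj (g x) := fun m x => by
  have h1 := hf m x
  have h2 := hg m x
  have h3 := exp_I_mul_conj (Φ / 2 * wedge (intVec m) x)
  change f (x + intVec m) * conj (g (x + intVec m)) = _
  rw [h1, h2, map_mul]
  linear_combination (f x * conj (g x)) * h3

theorem Equivariant.isPeriodic_norm_sq {f : Pt → ℂ} (hf : Equivariant Φ f) :
    IsPeriodic fun x => ‖f x‖ ^ 2 := fun m x => by
  change ‖f (x + intVec m)‖ ^ 2 = _
  rw [hf m x, norm_mul, norm_exp_I_mul, one_mul]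

theorem Equivariant.mul {f a : Pt → ℂ} (hf : Equivariant Φ f) (ha : IsPeriodic a) :
    Equivariant Φ fun x => a x * f x := fun m x => by
  simp only [hf m x, ha.add_intVec m x]; ring

theorem Equivariant.add {f g : Pt → ℂ} (hf : Equivariant Φ f) (hg : Equivariant Φ g) :
    Equivariant Φ fun x => f x + g x := fun m x => by
  simp only [hf m x, hg m x]; ring

theorem contDiff_covD {n m : ℕ} (hP : IsMagneticPotential Φ P B) {f : Pt → ℂ}
    (hf : ContDiff ℝ n f) (hmn : m + 1 ≤ n) (v : Pt) : ContDiff ℝ m (covD P v f) := by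
  have h1 : ContDiff ℝ m fun x => fderiv ℝ f x v :=
    (hf.fderiv_right (by exact_mod_cast hmn)).clm_apply contDiff_const
  have h2 : ContDiff ℝ m fun x => ((dotp v (P x) : ℝ) : ℂ) :=
    Complex.ofRealCLM.contDiff.comp (dotp_comp_contDiff (hP.contDiff m) v)
  have h3 : ContDiff ℝ m f := hf.of_le (by exact_mod_cast (Nat.le_succ m).trans hmn)
  exact (contDiff_const.mul h1).sub (h2.mul h3)

theorem Equivariant.covD (hP : IsMagneticPotential Φ P B) {f : Pt → ℂ} (hf : ContDiff ℝ 1 f)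
    (he : Equivariant Φ f) (v : Pt) : Equivariant Φ (covD P v f) := fun m x => by
  have h1 : (fun y => f (y + intVec m)) = fun y =>
      Complex.exp (Complex.I * (Φ / 2 * wedge (intVec m) y : ℝ)) * f y := funext (he m)
  have h2 := fderiv_comp_add_right (𝕜 := ℝ) (f := f) (x := x) (intVec m)
  have hw : HasFDerivAt (fun y : Pt => Φ / 2 * wedge (intVec m) y)
      ((Φ / 2) • ((intVec m).1 • ContinuousLinearMap.snd ℝ ℝ ℝ -
        (intVec m).2 • ContinuousLinearMap.fst ℝ ℝ ℝ)) x := by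
    unfold wedge
    exact (((hasFDerivAt_snd (𝕜 := ℝ)).const_mul (intVec m).1).sub
      ((hasFDerivAt_fst (𝕜 := ℝ)).const_mul (intVec m).2)).const_mul (Φ / 2)
  have hw' : HasFDerivAt (fun y : Pt => (((Φ / 2 * wedge (intVec m) y : ℝ)) : ℂ))
      (Complex.ofRealCLM.comp ((Φ / 2) • ((intVec m).1 • ContinuousLinearMap.snd ℝ ℝ ℝ -
        (intVec m).2 • ContinuousLinearMap.fst ℝ ℝ ℝ))) x :=
    Complex.ofRealCLM.hasFDerivAt.comp x hw
  have h3 := (hw'.const_mul Complex.I).cexp.mul (hf.differentiable one_ne_zero x).hasFDerivAt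
  have h4 := h3.fderiv
  rw [h1] at h2
  rw [_root_.covD, ← h2, he m x, hP.pot_add m x]
  erw [h4]
  simp only [dotp, A0, _root_.covD, wedge, intVec, _root_.add_apply, _root_.smul_apply,
    ContinuousLinearMap.comp_apply, _root_.sub_apply, ContinuousLinearMap.coe_fst',
    ContinuousLinearMap.coe_snd', smul_eq_mul, Complex.ofRealCLM_apply, Prod.fst_add, Prod.snd_add]
  push_cast
  ring_nf
  simp only [Complex.I_sq]
  ring_nf

theorem ip_covD (hP : IsMagneticPotential Φ P B) {f g : Pt → ℂ} (hf : ContDiff ℝ 1 f)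
    (hg : ContDiff ℝ 1 g) (hfe : Equivariant Φ f) (hge : Equivariant Φ g) (v : Pt) :
    ip (covD P v f) g = ip f (covD P v g) := by
  have hcg : ContDiff ℝ 1 fun x => conj (g x) := Complex.conjCLE.contDiff.comp hg
  have h := setIntegral_fund_fderiv (hf.mul hcg) (hfe.isPeriodic_mul_conj hge) v
  have hp : ∀ x, covD P v f x * conj (g x) - f x * conj (covD P v g x) =
      -Complex.I * fderiv ℝ (fun x => f x * conj (g x)) x v := fun x => by
    have h1 : HasFDerivAt (fun x => conj (g x))
        ((Complex.conjCLE : ℂ →L[ℝ] ℂ).comp (fderiv ℝ g x)) x :=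
      (Complex.conjCLE : ℂ →L[ℝ] ℂ).hasFDerivAt.comp x
        (hg.differentiable one_ne_zero x).hasFDerivAt
    have h2 := ((hf.differentiable one_ne_zero x).hasFDerivAt.mul h1).fderiv
    erw [h2]
    simp only [covD, _root_.add_apply, _root_.smul_apply, smul_eq_mul,
      ContinuousLinearMap.comp_apply, ContinuousLinearEquiv.coe_coe, Complex.conjCLE_apply,
      map_sub, map_mul, map_neg, Complex.conj_I, Complex.conj_ofReal]
    ring
  have hcf : Continuous (covD P v f) := (contDiff_covD (n := 1) (m := 0) hP hf le_rfl v).continuous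
  have hcg' : Continuous (covD P v g) := (contDiff_covD (n := 1) (m := 0) hP hg le_rfl v).continuous
  have hfc := hf.continuous
  have hgc := hg.continuous
  rw [← sub_eq_zero, ip, ip, ← integral_sub (Continuous.integrableOn_fund (by fun_prop))
    (Continuous.integrableOn_fund (by fun_prop))]
  simp_rw [hp]
  rw [integral_const_mul]
  erw [h]
  simp

theorem covD_mul {a f : Pt → ℂ} {x : Pt} (ha : DifferentiableAt ℝ a x)
    (hf : DifferentiableAt ℝ f x) (v : Pt) :
    covD P v (fun x => a x * f x) x =
      a x * covD P v f x - Complex.I * fderiv ℝ a x v * f x := by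
  have := (ha.hasFDerivAt.mul hf.hasFDerivAt).fderiv
  unfold covD
  erw [this]
  simp only [_root_.add_apply, _root_.smul_apply, smul_eq_mul]
  ring

theorem covD_add {f g : Pt → ℂ} {x : Pt} (hf : DifferentiableAt ℝ f x)
    (hg : DifferentiableAt ℝ g x) (v : Pt) :
    covD P v (fun x => f x + g x) x = covD P v f x + covD P v g x := by
  have := (hf.hasFDerivAt.add hg.hasFDerivAt).fderiv
  unfold covD
  erw [this]
  simp only [_root_.add_apply]
  ring

theorem covD_add_dir (f : Pt → ℂ) (x v w : Pt) :
    covD P (v + w) f x = covD P v f x + covD P w f x := by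
  simp only [covD, map_add, dotp, Prod.fst_add, Prod.snd_add]
  push_cast
  ring

theorem covD_smul_dir (f : Pt → ℂ) (x v : Pt) (c : ℝ) :
    covD P (c • v) f x = c * covD P v f x := by
  simp only [covD, map_smul, dotp, Prod.smul_fst, Prod.smul_snd, smul_eq_mul, Complex.real_smul]
  push_cast
  ring

theorem covD_const_mul {f : Pt → ℂ} {x : Pt} (hf : DifferentiableAt ℝ f x) (c : ℂ) (v : Pt) :
    covD P v (fun x => c * f x) x = c * covD P v f x := by
  rw [covD_mul (differentiableAt_const c) hf]
  simp

theorem fderiv_covD (hP : IsMagneticPotential Φ P B) {f : Pt → ℂ} (hf : ContDiff ℝ 2 f)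
    (x v w : Pt) : fderiv ℝ (covD P v f) x w = -Complex.I * fderiv ℝ (fderiv ℝ f) x w v -
      ((dotp v (fderiv ℝ P x w) : ℂ) * f x + (dotp v (P x) : ℂ) * fderiv ℝ f x w) := by
  have hd : DifferentiableAt ℝ (fderiv ℝ f) x :=
    (hf.fderiv_right (m := 1) (by norm_num)).differentiable one_ne_zero x
  have h1 : HasFDerivAt (fun y => fderiv ℝ f y v) ((fderiv ℝ (fderiv ℝ f) x).flip v) x :=
    by simpa using hd.hasFDerivAt.clm_apply (hasFDerivAt_const v x)
  have hPd : DifferentiableAt ℝ P x := (hP.contDiff 1).differentiable one_ne_zero x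
  have h2 : HasFDerivAt (fun y => ((dotp v (P y) : ℝ) : ℂ))
      (Complex.ofRealCLM.comp (fderiv ℝ (fun y => dotp v (P y)) x)) x :=
    Complex.ofRealCLM.hasFDerivAt.comp x ((dotp_comp_contDiff (hP.contDiff 1) v).differentiable
      one_ne_zero x).hasFDerivAt
  have h3 := ((h1.const_mul (-Complex.I)).sub
    (h2.mul (hf.differentiable two_ne_zero x).hasFDerivAt)).fderiv
  unfold covD
  erw [h3]
  simp only [_root_.sub_apply, _root_.add_apply,
    _root_.smul_apply, smul_eq_mul, ContinuousLinearMap.comp_apply,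
    Complex.ofRealCLM_apply, ContinuousLinearMap.flip_apply, fderiv_dotp_comp hPd]
  ring

theorem covD_covD_comm (hP : IsMagneticPotential Φ P B) {f : Pt → ℂ} (hf : ContDiff ℝ 2 f)
    (x v w : Pt) : covD P v (covD P w f) x =
      covD P w (covD P v f) x + Complex.I * (wedge v w * B x : ℝ) * f x := by
  have hs : fderiv ℝ (fderiv ℝ f) x w v = fderiv ℝ (fderiv ℝ f) x v w :=
    (hf.contDiffAt.isSymmSndFDerivAt (by simp)) w v
  rw [← hP.curl x v w]
  unfold covD
  erw [fderiv_covD hP hf x w v, fderiv_covD hP hf x v w]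
  rw [hs]
  push_cast
  ring

/-! ### Parallel transport -/

theorem Equivariant.transport (hP : IsMagneticPotential Φ P B) {f : Pt → ℂ}
    (he : Equivariant Φ f) (v : Pt) (s : ℝ) : Equivariant Φ (transport P v s f) := fun m x => by
  have h1 : rayIntegral 1 (fun y => dotp v (P y)) v 0 s (x + intVec m) =
      rayIntegral 1 (fun y => dotp v (P y)) v 0 s x + s * dotp v (A0 Φ (intVec m)) := by
    have hc : Continuous fun t : ℝ => dotp v (P (x + t • v)) :=
      (dotp_comp_contDiff (hP.contDiff 0) v).continuous.comp (by fun_prop)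
    have : ∀ t : ℝ, dotp v (P (x + intVec m + t • v)) =
        dotp v (P (x + t • v)) + dotp v (A0 Φ (intVec m)) := fun t => by
      rw [show x + intVec m + t • v = x + t • v + intVec m by abel, hP.pot_add]
      simp only [dotp, Prod.fst_add, Prod.snd_add]; ring
    simp only [rayIntegral, this, Pi.one_apply, one_mul]
    rw [intervalIntegral.integral_add (hc.intervalIntegrable _ _) intervalIntegrable_const]
    simp
  have h2 := he m (x + s • v)
  rw [show x + s • v + intVec m = x + intVec m + s • v by abel] at h2
  simp only [_root_.transport, h1, h2]
  rw [← mul_assoc, ← mul_assoc, ← Complex.exp_add, ← Complex.exp_add]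
  congr 2
  simp only [dotp, A0, wedge, intVec, Prod.fst_add, Prod.snd_add, Prod.smul_fst, Prod.smul_snd,
    smul_eq_mul]
  push_cast
  ring

theorem contDiff_transport {n : ℕ} (hP : IsMagneticPotential Φ P B) {f : Pt → ℂ}
    (hf : ContDiff ℝ n f) (v : Pt) (s : ℝ) : ContDiff ℝ n (transport P v s f) := by
  have h1 : ContDiff ℝ n (rayIntegral 1 (fun y => dotp v (P y)) v 0 s) :=
    ContDiff.rayIntegral contDiff_const (dotp_comp_contDiff (hP.contDiff n) v) v 0 s
  exact ((contDiff_const.mul (Complex.ofRealCLM.contDiff.comp h1)).cexp).mul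
    (hf.comp (by fun_prop))

theorem continuous_transport (hP : IsMagneticPotential Φ P B) {f : Pt → ℂ}
    (hf : Continuous f) (v : Pt) :
    Continuous fun p : ℝ × Pt => transport P v p.1 f p.2 := by
  have h1 := continuous_rayIntegral (ψ := 1) continuous_const
    (dotp_comp_contDiff (hP.contDiff 0) v).continuous v 0
  unfold transport
  exact (Complex.continuous_exp.comp (continuous_const.mul
    (Complex.continuous_ofReal.comp h1))).mul (hf.comp (by fun_prop))

theorem nrm_transport {f : Pt → ℂ} (hf : Continuous f)
    (he : Equivariant Φ f) (v : Pt) (s : ℝ) : nrm (transport P v s f) = nrm f := by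
  unfold nrm transport
  simp only [norm_mul, norm_exp_neg_I_mul, one_mul]
  rw [setIntegral_fund_add (by fun_prop) he.isPeriodic_norm_sq (s • v)]

theorem covD_transport (hP : IsMagneticPotential Φ P B) {f : Pt → ℂ} (hf : ContDiff ℝ 1 f)
    (v w : Pt) (s : ℝ) (x : Pt) : covD P w (transport P v s f) x =
      transport P v s (covD P w f) x + (twist B v w s x : ℂ) * transport P v s f x := by
  have hPd : Differentiable ℝ P := (hP.contDiff 1).differentiable one_ne_zero
  have hG := dotp_comp_contDiff (hP.contDiff 1) v
  have hφ : ContDiff ℝ 1 (rayIntegral 1 (fun y => dotp v (P y)) v 0 s) :=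
    ContDiff.rayIntegral contDiff_const hG v 0 s
  have h1 : HasFDerivAt (fun y => ((rayIntegral 1 (fun y => dotp v (P y)) v 0 s y : ℝ) : ℂ))
      (Complex.ofRealCLM.comp (fderiv ℝ (rayIntegral 1 (fun y => dotp v (P y)) v 0 s) x)) x :=
    Complex.ofRealCLM.hasFDerivAt.comp x (hφ.differentiable one_ne_zero x).hasFDerivAt
  have h2 : HasFDerivAt (fun y => f (y + s • v)) (fderiv ℝ f (x + s • v)) x := by
    have := (hf.differentiable one_ne_zero (x + s • v)).hasFDerivAt.comp x
      ((hasFDerivAt_id x).add_const (s • v))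
    rw [ContinuousLinearMap.comp_id] at this
    exact this
  have h3 := ((h1.const_mul (-Complex.I)).cexp.mul h2).fderiv
  have h4 : (twist B v w s x : ℝ) = dotp w (P (x + s • v)) - dotp w (P x) -
      fderiv ℝ (rayIntegral 1 (fun y => dotp v (P y)) v 0 s) x w := by
    have h5 := integral_fderiv_ray (dotp_comp_contDiff (hP.contDiff 1) w) x v 0 s
    simp only [zero_smul, add_zero] at h5
    have hc : ∀ a b : Pt, Continuous fun t : ℝ => dotp a (fderiv ℝ P (x + t • v) b) :=
      fun a b => (dotp_comp_contDiff (contDiff_zero.2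
        (((hP.contDiff 1).continuous_fderiv one_ne_zero).clm_apply continuous_const)) a
        ).continuous.comp (by fun_prop : Continuous fun t : ℝ => x + t • v)
    rw [← h5, fderiv_rayIntegral (ψ := 1) contDiff_const hG]
    simp only [rayIntegral, Pi.one_apply, one_mul, fderiv_dotp_comp (hPd _), twist]
    rw [← intervalIntegral.integral_sub ((hc _ _).intervalIntegrable _ _)
      ((hc _ _).intervalIntegrable _ _), ← intervalIntegral.integral_const_mul]
    simp only [hP.curl]
  rw [h4]
  unfold transport covD
  erw [h3]
  simp only [_root_.add_apply, _root_.smul_apply, smul_eq_mul,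
    ContinuousLinearMap.comp_apply, Complex.ofRealCLM_apply]
  push_cast
  linear_combination
    (Complex.exp (-Complex.I * (rayIntegral 1 (fun y => dotp v (P y)) v 0 s x : ℝ)) *
    f (x + s • v) * ((fderiv ℝ (rayIntegral 1 (fun y => dotp v (P y)) v 0 s) x w : ℝ) : ℂ)) *
    Complex.I_sq

theorem twist_self (v : Pt) (s : ℝ) (x : Pt) : twist B v v s x = 0 := by
  simp [twist, wedge, mul_comm]

theorem hasDerivAt_transport (hP : IsMagneticPotential Φ P B) {f : Pt → ℂ} (hf : ContDiff ℝ 1 f)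
    (v : Pt) (s : ℝ) (x : Pt) : HasDerivAt (fun s => transport P v s f x)
      (Complex.I * transport P v s (covD P v f) x) s := by
  have hc : Continuous fun t : ℝ => dotp v (P (x + t • v)) :=
    (dotp_comp_contDiff (hP.contDiff 0) v).continuous.comp (by fun_prop)
  have h1 : HasDerivAt (fun s => rayIntegral 1 (fun y => dotp v (P y)) v 0 s x)
      (dotp v (P (x + s • v))) s := by
    simp only [rayIntegral, Pi.one_apply, one_mul]
    exact (hc.integral_hasStrictDerivAt 0 s).hasDerivAt
  have h2 := ((h1.ofReal_comp.const_mul (-Complex.I)).cexp).mul (hasDerivAt_comp_ray hf x v s)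
  refine h2.congr_deriv ?_
  simp only [transport, covD]
  linear_combination (Complex.exp (-Complex.I *
    (rayIntegral 1 (fun y => dotp v (P y)) v 0 s x : ℝ)) * fderiv ℝ f (x + s • v) v) *
    Complex.I_sq

theorem integral_transport_covD (hP : IsMagneticPotential Φ P B) {f : Pt → ℂ}
    (hf : ContDiff ℝ 1 f) (v x : Pt) (a b : ℝ) :
    ∫ s in a..b, Complex.I * transport P v s (covD P v f) x =
      transport P v b f x - transport P v a f x := by
  have hc : Continuous (covD P v f) := (contDiff_covD (n := 1) (m := 0) hP hf le_rfl v).continuous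
  refine intervalIntegral.integral_eq_sub_of_hasDerivAt
    (fun s _ => hasDerivAt_transport hP hf v s x) (Continuous.intervalIntegrable ?_ _ _)
  have h1 : Continuous ((fun p : ℝ × Pt => transport P v p.1 (covD P v f) p.2) ∘ fun s => (s, x)) :=
    (continuous_transport hP hc v).comp (continuous_id.prodMk continuous_const)
  exact continuous_const.mul h1

/-- The pairing `⟨a · V_s f, g⟩`, where `V_s` is the parallel transport along `v`. -/
noncomputable def corr (P : Pt → Pt) (v : Pt) (a f g : Pt → ℂ) (s : ℝ) : ℂ :=
  ip (fun x => a x * transport P v s f x) g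

theorem continuous_corr (hP : IsMagneticPotential Φ P B) {a f g : Pt → ℂ} (ha : Continuous a)
    (hf : Continuous f) (hg : Continuous g) (v : Pt) : Continuous (corr P v a f g) := by
  have hT := continuous_transport hP hf v
  exact continuous_setIntegral_fund (F := fun s x => a x * transport P v s f x * conj (g x))
    (((ha.comp continuous_snd).mul hT).mul
      (Complex.continuous_conj.comp (hg.comp continuous_snd)))

theorem integral_corr (hP : IsMagneticPotential Φ P B) {a f g : Pt → ℂ} (ha : Continuous a)
    (hf : Continuous f) (hg : Continuous g) (v : Pt) (s t : ℝ) :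
    ∫ r in s..t, corr P v a f g r =
      ip (fun x => a x * ∫ r in s..t, transport P v r f x) g := by
  have hT := continuous_transport hP hf v
  refine (integral_setIntegral_fund_swap
    (F := fun r x => a x * transport P v r f x * conj (g x)) (((ha.comp continuous_snd).mul hT).mul
      (Complex.continuous_conj.comp (hg.comp continuous_snd))) s t).trans ?_
  unfold ip
  simp_rw [intervalIntegral.integral_mul_const, intervalIntegral.integral_const_mul]

theorem integral_corr_covD (hP : IsMagneticPotential Φ P B) {a f g : Pt → ℂ} (ha : Continuous a)
    (hf : ContDiff ℝ 1 f) (hg : Continuous g) (v : Pt) (s t : ℝ) :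
    ∫ r in s..t, corr P v a (covD P v f) g r =
      -Complex.I * (corr P v a f g t - corr P v a f g s) := by
  have hc : Continuous (covD P v f) := (contDiff_covD (n := 1) (m := 0) hP hf le_rfl v).continuous
  have hT : ∀ s, Continuous (transport P v s f) := fun s =>
    (contDiff_transport (n := 1) hP hf v s).continuous
  have h1 := hT s
  have h2 := hT t
  rw [integral_corr hP ha hc hg, corr, corr, ← ip_sub_left (by fun_prop) (by fun_prop) hg,
    ← ip_const_mul_left]
  congr 1
  funext x
  have h := integral_transport_covD hP hf v x s t
  rw [intervalIntegral.integral_const_mul] at h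
  rw [← mul_sub, ← h]
  linear_combination (a x * ∫ r in s..t, transport P v r (covD P v f) x) * Complex.I_sq

theorem norm_corr_le (hP : IsMagneticPotential Φ P B) {a f g : Pt → ℂ} {M : ℝ} (hM : 0 ≤ M)
    (ha : Continuous a) (haM : ∀ x, ‖a x‖ ≤ M) (hf : Continuous f) (he : Equivariant Φ f)
    (hg : Continuous g) (v : Pt) (s : ℝ) : ‖corr P v a f g s‖ ≤ M * nrm f * nrm g := by
  have hT : Continuous (transport P v s f) :=
    (contDiff_transport (n := 0) hP (contDiff_zero.2 hf) v s).continuous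
  refine (norm_ip_le (by fun_prop) hg).trans ?_
  gcongr
  · exact nrm_nonneg g
  · exact (nrm_mul_le hM ha hT haM).trans_eq (by rw [nrm_transport hf he])

theorem transport_mul_conj_transport (hP : IsMagneticPotential Φ P B) (f g : Pt → ℂ) (v : Pt)
    (s t : ℝ) (x : Pt) :
    transport P v s f (x + (-t) • v) * conj (transport P v t g (x + (-t) • v)) =
      transport P v (s - t) f x * conj (g x) := by
  have hc : Continuous fun r : ℝ => dotp v (P (x + (-t) • v + r • v)) :=
    (dotp_comp_contDiff (hP.contDiff 0) v).continuous.comp (by fun_prop)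
  have h1 : rayIntegral 1 (fun y => dotp v (P y)) v 0 s (x + (-t) • v) -
      rayIntegral 1 (fun y => dotp v (P y)) v 0 t (x + (-t) • v) =
      rayIntegral 1 (fun y => dotp v (P y)) v 0 (s - t) x := by
    simp only [rayIntegral, Pi.one_apply, one_mul]
    rw [intervalIntegral.integral_interval_sub_left (hc.intervalIntegrable _ _)
      (hc.intervalIntegrable _ _)]
    have := intervalIntegral.integral_comp_sub_right (a := t) (b := s)
      (fun r : ℝ => dotp v (P (x + r • v))) t
    rw [sub_self] at this
    rw [← this]
    refine intervalIntegral.integral_congr fun r _ => ?_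
    rw [show x + (-t) • v + r • v = x + (r - t) • v by module]
  simp only [transport, map_mul, ← Complex.exp_conj, Complex.conj_ofReal, Complex.conj_I, map_neg]
  rw [show x + (-t) • v + s • v = x + (s - t) • v by module,
    show x + (-t) • v + t • v = x by module, ← h1]
  have h2 : Complex.exp (-Complex.I * ((rayIntegral 1 (fun y => dotp v (P y)) v 0 s (x + (-t) • v) -
      rayIntegral 1 (fun y => dotp v (P y)) v 0 t (x + (-t) • v) : ℝ) : ℂ)) =
      Complex.exp (-Complex.I * (rayIntegral 1 (fun y => dotp v (P y)) v 0 s (x + (-t) • v) : ℝ)) *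
      Complex.exp
        (- -Complex.I * (rayIntegral 1 (fun y => dotp v (P y)) v 0 t (x + (-t) • v) : ℝ)) := by
    rw [← Complex.exp_add]
    push_cast
    ring_nf
  rw [h2]
  ring

end Covariant

/-! ### Commutation of the Laplacian with weighted parallel transport -/

/-- The symbol produced when `covD P w` is moved through `a · V_s`, with `V_s` the parallel
transport along `v`. -/
noncomputable def twistD (B : Pt → ℝ) (v w : Pt) (s : ℝ) (a : Pt → ℂ) : Pt → ℂ := fun x =>
  a x * twist B v w s x - Complex.I * fderiv ℝ a x w

/-- The operator `h²((-i∂_v - v·P)² + (-i∂_w - w·P)²) - N`. -/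
noncomputable def lapOp (P : Pt → Pt) (v w : Pt) (N h : ℝ) (f : Pt → ℂ) : Pt → ℂ := fun x =>
  (h : ℂ) ^ 2 * (covD P v (covD P v f) x + covD P w (covD P w f) x) - N * f x

section Commutation

variable {Φ : ℝ} {P : Pt → Pt} {B : Pt → ℝ}

theorem contDiff_rayIntegral_field (hP : IsMagneticPotential Φ P B) (n : ℕ) (v : Pt) (s : ℝ) :
    ContDiff ℝ n (rayIntegral 1 B v 0 s) :=
  ContDiff.rayIntegral contDiff_const (hP.contDiff_field n) v 0 s

theorem contDiff_twist (hP : IsMagneticPotential Φ P B) (n : ℕ) (v w : Pt) (s : ℝ) :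
    ContDiff ℝ n fun x => (twist B v w s x : ℂ) := by
  unfold twist
  exact Complex.ofRealCLM.contDiff.comp
    (contDiff_const.mul (contDiff_rayIntegral_field hP n v s))

theorem contDiff_twistD (hP : IsMagneticPotential Φ P B) {n m : ℕ} {a : Pt → ℂ}
    (ha : ContDiff ℝ n a) (hmn : m + 1 ≤ n) (v w : Pt) (s : ℝ) :
    ContDiff ℝ m (twistD B v w s a) := by
  have h1 : ContDiff ℝ m fun x => fderiv ℝ a x w :=
    (ha.fderiv_right (by exact_mod_cast hmn)).clm_apply contDiff_const
  have h3 : ContDiff ℝ m a := ha.of_le (by exact_mod_cast (Nat.le_succ m).trans hmn)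
  exact (h3.mul (contDiff_twist hP m v w s)).sub (contDiff_const.mul h1)

theorem covD_mul_transport (hP : IsMagneticPotential Φ P B) {a f : Pt → ℂ}
    (ha : ContDiff ℝ 1 a) (hf : ContDiff ℝ 1 f) (v w : Pt) (s : ℝ) :
    covD P w (fun x => a x * transport P v s f x) = fun x =>
      a x * transport P v s (covD P w f) x + twistD B v w s a x * transport P v s f x := by
  funext x
  rw [covD_mul (ha.differentiable one_ne_zero x)
    ((contDiff_transport (n := 1) hP hf v s).differentiable one_ne_zero x),
    covD_transport hP hf, twistD]
  ring

theorem covD_covD_mul_transport (hP : IsMagneticPotential Φ P B) {a f : Pt → ℂ}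
    (ha : ContDiff ℝ 2 a) (hf : ContDiff ℝ 2 f) (v w : Pt) (s : ℝ) (x : Pt) :
    covD P w (covD P w (fun x => a x * transport P v s f x)) x =
      a x * transport P v s (covD P w (covD P w f)) x +
      2 * (twistD B v w s a x * transport P v s (covD P w f) x) +
      twistD B v w s (twistD B v w s a) x * transport P v s f x := by
  have ha1 : ContDiff ℝ 1 a := ha.of_le one_le_two
  have hf1 : ContDiff ℝ 1 f := hf.of_le one_le_two
  have ha' := contDiff_twistD (n := 2) (m := 1) hP ha le_rfl v w s
  have hf' := contDiff_covD (n := 2) (m := 1) hP hf le_rfl w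
  have hT := contDiff_transport (n := 1) hP hf1 v s
  have hT' := contDiff_transport (n := 1) hP hf' v s
  rw [covD_mul_transport hP ha1 hf1, covD_add
    ((ha1.mul hT').differentiable one_ne_zero x) ((ha'.mul hT).differentiable one_ne_zero x),
    covD_mul_transport hP ha1 hf', covD_mul_transport hP ha' hf1]
  ring

theorem continuous_lapOp (hP : IsMagneticPotential Φ P B) {f : Pt → ℂ} (hf : ContDiff ℝ 2 f)
    (v w : Pt) (N h : ℝ) : Continuous (lapOp P v w N h f) := by
  have h0 := hf.continuous
  have h1 : ∀ v, Continuous (covD P v (covD P v f)) := fun v =>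
    (contDiff_covD (n := 1) (m := 0) hP
      (contDiff_covD (n := 2) (m := 1) hP hf le_rfl v) le_rfl v).continuous
  have h2 := h1 v
  have h3 := h1 w
  unfold lapOp
  fun_prop

theorem Equivariant.lapOp (hP : IsMagneticPotential Φ P B) {f : Pt → ℂ} (hf : ContDiff ℝ 2 f)
    (he : Equivariant Φ f) (v w : Pt) (N h : ℝ) : Equivariant Φ (lapOp P v w N h f) := by
  have h1 : ∀ v, Equivariant Φ (_root_.covD P v (_root_.covD P v f)) := fun v =>
    (he.covD hP (hf.of_le one_le_two) v).covD hP
      (contDiff_covD (n := 2) (m := 1) hP hf le_rfl v) v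
  intro m x
  simp only [_root_.lapOp, h1 v m x, h1 w m x, he m x]
  ring

theorem lapOp_mul_transport (hP : IsMagneticPotential Φ P B) {a f : Pt → ℂ}
    (ha : ContDiff ℝ 2 a) (hf : ContDiff ℝ 2 f) (v w : Pt) (N h s : ℝ) (x : Pt) :
    lapOp P v w N h (fun x => a x * transport P v s f x) x =
      a x * transport P v s (lapOp P v w N h f) x + (h : ℂ) ^ 2 * (
      2 * (twistD B v v s a x * transport P v s (covD P v f) x) +
      2 * (twistD B v w s a x * transport P v s (covD P w f) x) +
      twistD B v v s (twistD B v v s a) x * transport P v s f x +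
      twistD B v w s (twistD B v w s a) x * transport P v s f x) := by
  rw [lapOp, covD_covD_mul_transport hP ha hf, covD_covD_mul_transport hP ha hf]
  simp only [transport, lapOp]
  ring

theorem ip_lapOp_mul_transport (hP : IsMagneticPotential Φ P B) {a f g : Pt → ℂ}
    (ha : ContDiff ℝ 2 a) (hf : ContDiff ℝ 2 f) (hg : Continuous g) (v w : Pt) (N h s : ℝ) :
    ip (lapOp P v w N h (fun x => a x * transport P v s f x)) g =
      corr P v a (lapOp P v w N h f) g s + (h : ℂ) ^ 2 * (
      2 * corr P v (twistD B v v s a) (covD P v f) g s +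
      2 * corr P v (twistD B v w s a) (covD P w f) g s +
      corr P v (twistD B v v s (twistD B v v s a)) f g s +
      corr P v (twistD B v w s (twistD B v w s a)) f g s) := by
  have ha1 := fun w => contDiff_twistD (n := 2) (m := 1) hP ha le_rfl v w s
  have ha2 := fun w => (contDiff_twistD (n := 1) (m := 0) hP (ha1 w) le_rfl v w s).continuous
  have hf1 := fun w => contDiff_covD (n := 2) (m := 1) hP hf le_rfl w
  have hT : ∀ {f : Pt → ℂ}, Continuous f → Continuous (transport P v s f) := fun hf =>
    (contDiff_transport (n := 0) hP (contDiff_zero.2 hf) v s).continuous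
  have c0 := ha.continuous
  have c1 := (ha1 v).continuous
  have c2 := (ha1 w).continuous
  have c3 := ha2 v
  have c4 := ha2 w
  have t0 := hT hf.continuous
  have t1 := hT (hf1 v).continuous
  have t2 := hT (hf1 w).continuous
  have t3 := hT (continuous_lapOp hP hf v w N h)
  rw [funext (lapOp_mul_transport hP ha hf v w N h s), ip_add_left (by fun_prop) (by fun_prop) hg,
    ip_const_mul_left, ip_add_left (by fun_prop) (by fun_prop) hg,
    ip_add_left (by fun_prop) (by fun_prop) hg, ip_add_left (by fun_prop) (by fun_prop) hg,
    ip_const_mul_left, ip_const_mul_left]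
  rfl

theorem ip_lapOp_left (hP : IsMagneticPotential Φ P B) {f g : Pt → ℂ} (hf : ContDiff ℝ 2 f)
    (hg : Continuous g) (v w : Pt) (N h : ℝ) :
    ip (lapOp P v w N h f) g = (h : ℂ) ^ 2 * (ip (covD P v (covD P v f)) g +
      ip (covD P w (covD P w f)) g) - N * ip f g := by
  have h0 := hf.continuous
  have h1 : ∀ v, Continuous (covD P v (covD P v f)) := fun v =>
    (contDiff_covD (n := 1) (m := 0) hP
      (contDiff_covD (n := 2) (m := 1) hP hf le_rfl v) le_rfl v).continuous
  have h2 := h1 v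
  have h3 := h1 w
  unfold lapOp
  rw [ip_sub_left (by fun_prop) (by fun_prop) hg, ip_const_mul_left, ip_const_mul_left,
    ip_add_left (by fun_prop) (by fun_prop) hg]

theorem ip_lapOp_right (hP : IsMagneticPotential Φ P B) {f g : Pt → ℂ} (hf : Continuous f)
    (hg : ContDiff ℝ 2 g) (v w : Pt) (N h : ℝ) :
    ip f (lapOp P v w N h g) = (h : ℂ) ^ 2 * (ip f (covD P v (covD P v g)) +
      ip f (covD P w (covD P w g))) - N * ip f g := by
  rw [← conj_ip, ip_lapOp_left hP hg hf, map_sub, map_mul, map_mul, map_pow, map_add, conj_ip,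
    conj_ip, conj_ip, Complex.conj_ofReal, Complex.conj_ofReal]

theorem ip_lapOp (hP : IsMagneticPotential Φ P B) {f g : Pt → ℂ} (hf : ContDiff ℝ 2 f)
    (hg : ContDiff ℝ 2 g) (hfe : Equivariant Φ f) (hge : Equivariant Φ g) (v w : Pt) (N h : ℝ) :
    ip (lapOp P v w N h f) g = ip f (lapOp P v w N h g) := by
  have hf1 : ContDiff ℝ 1 f := hf.of_le one_le_two
  have hg1 : ContDiff ℝ 1 g := hg.of_le one_le_two
  have hs : ∀ v, ip (covD P v (covD P v f)) g = ip f (covD P v (covD P v g)) := fun v => by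
    have hf' := contDiff_covD (n := 2) (m := 1) hP hf le_rfl v
    have hg' := contDiff_covD (n := 2) (m := 1) hP hg le_rfl v
    rw [ip_covD hP hf' hg1 (hfe.covD hP hf1 v) hge, ip_covD hP hf1 hg' hfe (hge.covD hP hg1 v)]
  rw [ip_lapOp_left hP hf hg.continuous, ip_lapOp_right hP hf.continuous hg, hs, hs]

/-- The commutator of `covD P w` with the magnetic Laplacian, in weak form. -/
theorem ip_covD_lapOp (hP : IsMagneticPotential Φ P B) {f g : Pt → ℂ} (hf : ContDiff ℝ 2 f)
    (hg : ContDiff ℝ 2 g) (hfe : Equivariant Φ f) (hge : Equivariant Φ g) (v w : Pt) (N h : ℝ) :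
    ip (covD P w f) (lapOp P v w N h g) = ip (lapOp P v w N h f) (covD P w g) +
      (h : ℂ) ^ 2 * (Complex.I * wedge v w * (ip (fun x => (B x : ℂ) * f x) (covD P v g) +
        ip (covD P v f) (fun x => (B x : ℂ) * g x))) := by
  have hf1 : ContDiff ℝ 1 f := hf.of_le one_le_two
  have hg1 : ContDiff ℝ 1 g := hg.of_le one_le_two
  have hf' := fun v => contDiff_covD (n := 2) (m := 1) hP hf le_rfl v
  have hg' := fun v => contDiff_covD (n := 2) (m := 1) hP hg le_rfl v
  have hf2 := fun v w => (contDiff_covD (n := 1) (m := 0) hP (hf' v) le_rfl w).continuous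
  have hg2 := fun v w => (contDiff_covD (n := 1) (m := 0) hP (hg' v) le_rfl w).continuous
  have hfe' := fun v => hfe.covD hP hf1 v
  have hge' := fun v => hge.covD hP hg1 v
  have cB : Continuous fun x => (B x : ℂ) :=
    Complex.continuous_ofReal.comp (hP.contDiff_field 0).continuous
  have cf := hf.continuous
  have cg := hg.continuous
  have e1 : ip (covD P w f) (covD P w (covD P w g)) = ip (covD P w (covD P w f)) (covD P w g) :=
    (ip_covD hP (hf' w) (hg' w) (hfe' w) (hge' w) w).symm
  have c1 : covD P v (covD P w f) = fun x => covD P w (covD P v f) x +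
      (Complex.I * wedge v w) * (B x * f x) := funext fun x => by
    rw [covD_covD_comm hP hf]; push_cast; ring
  have c2 : covD P w (covD P v g) = fun x => covD P v (covD P w g) x -
      (Complex.I * wedge v w) * (B x * g x) := funext fun x => by
    rw [covD_covD_comm hP hg, show wedge w v = -wedge v w by unfold wedge; ring]; push_cast; ring
  have e2 : ip (covD P w f) (covD P v (covD P v g)) = ip (covD P v (covD P v f)) (covD P w g) +
      (Complex.I * wedge v w * (ip (fun x => (B x : ℂ) * f x) (covD P v g) +
        ip (covD P v f) (fun x => (B x : ℂ) * g x))) := by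
    have k1 := hf2 v w
    have k2 := hg2 w v
    have k3 := (hf' v).continuous
    have k4 := (hg' v).continuous
    rw [← ip_covD hP (hf' w) (hg' v) (hfe' w) (hge' v), c1,
      ip_add_left k1 (by fun_prop) k4, ip_const_mul_left,
      ip_covD hP (hf' v) (hg' v) (hfe' v) (hge' v), c2,
      ip_sub_right k3 k2 (by fun_prop), ip_const_mul_right,
      ← ip_covD hP (hf' v) (hg' w) (hfe' v) (hge' w)]
    simp only [map_mul, Complex.conj_I, Complex.conj_ofReal]
    ring
  rw [ip_lapOp_right hP (hf' w).continuous hg, ip_lapOp_left hP hf (hg' w).continuous, e1, e2,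
    ip_covD hP hf1 hg1 hfe hge]
  ring

end Commutation

/-! ### Quasimode estimates -/

/-- A normalized equivariant quasimode of `h²((-i∂_v - v·P)² + (-i∂_w - w·P)²) - v ∧ w` with
error at most `ρ`. -/
structure IsQuasimode (Φ : ℝ) (P : Pt → Pt) (v w : Pt) (h ρ : ℝ) (u : Pt → ℂ) : Prop where
  contDiff : ContDiff ℝ 2 u
  equivariant : Equivariant Φ u
  nrm_eq_one : nrm u = 1
  h_pos : 0 < h
  h_le_one : h ≤ 1
  error_le_one : ρ ≤ 1
  nrm_lapOp_le : nrm (lapOp P v w (wedge v w) h u) ≤ ρ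

/-- A periodic symbol which is bounded by `M`, together with its first and pure second twisted
derivatives in the directions `v` and `w`. -/
structure BoundedSymbol (B : Pt → ℝ) (v w : Pt) (s M : ℝ) (a : Pt → ℂ) : Prop where
  contDiff : ContDiff ℝ 2 a
  periodic : IsPeriodic a
  norm_le : ∀ x, ‖a x‖ ≤ M
  norm_left_le : ∀ x, ‖twistD B v v s a x‖ ≤ M
  norm_right_le : ∀ x, ‖twistD B v w s a x‖ ≤ M
  norm_left_left_le : ∀ x, ‖twistD B v v s (twistD B v v s a) x‖ ≤ M
  norm_right_right_le : ∀ x, ‖twistD B v w s (twistD B v w s a) x‖ ≤ M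

section Quasimode

variable {Φ : ℝ} {P : Pt → Pt} {B : Pt → ℝ} {v w : Pt} {h ρ : ℝ} {u : Pt → ℂ}

theorem nrm_add_le {f g : Pt → ℂ} (hf : Continuous f) (hg : Continuous g) :
    nrm (fun x => f x + g x) ≤ nrm f + nrm g := by
  have h1 : ((nrm (fun x => f x + g x) ^ 2 : ℝ) : ℂ) =
      ((nrm f ^ 2 : ℝ) : ℂ) + ip f g + (ip g f + ((nrm g ^ 2 : ℝ) : ℂ)) := by
    rw [← ip_self, ← ip_self, ← ip_self, ip_add_left hf hg (by fun_prop), ip_add_right hf hf hg,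
      ip_add_right hg hf hg]
  have h2 := congrArg Complex.re h1
  simp only [Complex.add_re, Complex.ofReal_re] at h2
  have h3 := (Complex.re_le_norm _).trans (norm_ip_le hf hg)
  have h4 := (Complex.re_le_norm _).trans (norm_ip_le hg hf)
  refine abs_le_of_sq_le_sq' ?_ (add_nonneg (nrm_nonneg f) (nrm_nonneg g)) |>.2
  nlinarith

namespace IsQuasimode

theorem error_nonneg (hu : IsQuasimode Φ P v w h ρ u) : 0 ≤ ρ :=
  (nrm_nonneg _).trans hu.nrm_lapOp_le

theorem contDiff_one (hu : IsQuasimode Φ P v w h ρ u) : ContDiff ℝ 1 u :=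
  hu.contDiff.of_le one_le_two

theorem energy_le (hP : IsMagneticPotential Φ P B) (hu : IsQuasimode Φ P v w h ρ u) :
    h ^ 2 * (nrm (covD P v u) ^ 2 + nrm (covD P w u) ^ 2) ≤ |wedge v w| + 1 := by
  have h1 : ContDiff ℝ 1 u := hu.contDiff_one
  have hd := fun v => contDiff_covD (n := 2) (m := 1) hP hu.contDiff le_rfl v
  have he := fun v => hu.equivariant.covD hP h1 v
  have key := ip_lapOp_left hP hu.contDiff hu.contDiff.continuous v w (wedge v w) h
  rw [ip_covD hP (hd v) h1 (he v) hu.equivariant, ip_covD hP (hd w) h1 (he w) hu.equivariant,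
    ip_self, ip_self, ip_self, hu.nrm_eq_one, one_pow, Complex.ofReal_one, mul_one] at key
  have h2 := norm_ip_le (continuous_lapOp hP hu.contDiff v w (wedge v w) h) hu.contDiff.continuous
  rw [hu.nrm_eq_one, mul_one] at h2
  have h3 := ((Complex.re_le_norm _).trans h2).trans (hu.nrm_lapOp_le.trans hu.error_le_one)
  rw [key] at h3
  norm_cast at h3
  have := le_abs_self (wedge v w)
  linarith

theorem mul_nrm_covD_left_le (hP : IsMagneticPotential Φ P B) (hu : IsQuasimode Φ P v w h ρ u) :
    h * nrm (covD P v u) ≤ |wedge v w| + 1 := by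
  have h1 := hu.energy_le hP
  have h2 := abs_nonneg (wedge v w)
  refine abs_le_of_sq_le_sq' ?_ (by positivity) |>.2
  have := mul_nonneg (sq_nonneg h) (sq_nonneg (nrm (covD P w u)))
  nlinarith

theorem mul_nrm_covD_right_le (hP : IsMagneticPotential Φ P B) (hu : IsQuasimode Φ P v w h ρ u) :
    h * nrm (covD P w u) ≤ |wedge v w| + 1 := by
  have h1 := hu.energy_le hP
  have h2 := abs_nonneg (wedge v w)
  refine abs_le_of_sq_le_sq' ?_ (by positivity) |>.2
  have := mul_nonneg (sq_nonneg h) (sq_nonneg (nrm (covD P v u)))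
  nlinarith

theorem nrm_covD_left_le (hP : IsMagneticPotential Φ P B) (hu : IsQuasimode Φ P v w h ρ u) :
    nrm (covD P v u) ≤ (|wedge v w| + 1) / h :=
  (le_div_iff₀' hu.h_pos).2 (hu.mul_nrm_covD_left_le hP)

theorem nrm_covD_right_le (hP : IsMagneticPotential Φ P B) (hu : IsQuasimode Φ P v w h ρ u) :
    nrm (covD P w u) ≤ (|wedge v w| + 1) / h :=
  (le_div_iff₀' hu.h_pos).2 (hu.mul_nrm_covD_right_le hP)

theorem norm_corr_self_le (hP : IsMagneticPotential Φ P B) (hu : IsQuasimode Φ P v w h ρ u)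
    {a : Pt → ℂ} {M : ℝ} (hM : 0 ≤ M) (ha : Continuous a) (haM : ∀ x, ‖a x‖ ≤ M) (s : ℝ) :
    ‖corr P v a u u s‖ ≤ M := by
  simpa [hu.nrm_eq_one] using norm_corr_le hP hM ha haM hu.contDiff.continuous hu.equivariant
    hu.contDiff.continuous v s

variable {s M : ℝ} {a : Pt → ℂ}

/-- Pairing the transported equation with `u`. -/
theorem norm_corr_add_corr_le (hP : IsMagneticPotential Φ P B)
    (hu : IsQuasimode Φ P v w h ρ u) (hM : 0 ≤ M) (ha : BoundedSymbol B v w s M a) :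
    h ^ 2 * ‖corr P v (twistD B v v s a) (covD P v u) u s +
      corr P v (twistD B v w s a) (covD P w u) u s‖ ≤ M * (h ^ 2 + ρ) := by
  have hu2 := hu.contDiff
  have hT := contDiff_transport (n := 2) hP hu2 v s
  have ha1 := fun w => contDiff_twistD (n := 2) (m := 1) hP ha.contDiff le_rfl v w s
  have ha2 := fun w => (contDiff_twistD (n := 1) (m := 0) hP (ha1 w) le_rfl v w s).continuous
  have hr := continuous_lapOp hP hu2 v w (wedge v w) h
  have hre := hu.equivariant.lapOp hP hu2 v w (wedge v w) h
  set r := lapOp P v w (wedge v w) h u with hrdef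
  have e1 := ip_lapOp hP (ha.contDiff.mul hT) hu2
    ((hu.equivariant.transport hP v s).mul ha.periodic) hu.equivariant v w (wedge v w) h
  have e2 := ip_lapOp_mul_transport hP ha.contDiff hu2 hu2.continuous v w (wedge v w) h s
  rw [← hrdef] at e1 e2
  have e3 : 2 * ((h : ℂ) ^ 2 * (corr P v (twistD B v v s a) (covD P v u) u s +
      corr P v (twistD B v w s a) (covD P w u) u s)) =
      corr P v a u r s - corr P v a r u s - (h : ℂ) ^ 2 *
      (corr P v (twistD B v v s (twistD B v v s a)) u u s +
      corr P v (twistD B v w s (twistD B v w s a)) u u s) := by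
    have : corr P v a u r s = ip (lapOp P v w (wedge v w) h
      fun x => a x * transport P v s u x) u := e1.symm
    rw [this, e2]
    ring
  have b1 : ‖corr P v a u r s‖ ≤ M * ρ := by
    refine (norm_corr_le hP hM ha.contDiff.continuous ha.norm_le hu2.continuous hu.equivariant
      hr v s).trans ?_
    rw [hu.nrm_eq_one, mul_one]
    gcongr
    exact hu.nrm_lapOp_le
  have b2 : ‖corr P v a r u s‖ ≤ M * ρ := by
    refine (norm_corr_le hP hM ha.contDiff.continuous ha.norm_le hr hre
      hu2.continuous v s).trans ?_
    rw [hu.nrm_eq_one, mul_one]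
    gcongr
    exact hu.nrm_lapOp_le
  have b3 := hu.norm_corr_self_le hP hM (ha2 v) ha.norm_left_left_le s
  have b4 := hu.norm_corr_self_le hP hM (ha2 w) ha.norm_right_right_le s
  have e4 := congrArg norm e3
  rw [norm_mul, norm_mul, norm_pow, Complex.norm_real, Complex.norm_ofNat, Real.norm_eq_abs,
    sq_abs] at e4
  have b5 := norm_sub_le (corr P v a u r s - corr P v a r u s) ((h : ℂ) ^ 2 *
      (corr P v (twistD B v v s (twistD B v v s a)) u u s +
      corr P v (twistD B v w s (twistD B v w s a)) u u s))
  rw [norm_mul, norm_pow, Complex.norm_real, Real.norm_eq_abs, sq_abs] at b5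
  have b6 := norm_sub_le (corr P v a u r s) (corr P v a r u s)
  have b7 := mul_le_mul_of_nonneg_left ((norm_add_le
    (corr P v (twistD B v v s (twistD B v v s a)) u u s)
    (corr P v (twistD B v w s (twistD B v w s a)) u u s)).trans (add_le_add b3 b4)) (sq_nonneg h)
  linarith

/-- Pairing the transported equation with `covD P w u`. -/
theorem norm_corr_covD_add_corr_covD_le (hP : IsMagneticPotential Φ P B)
    (hu : IsQuasimode Φ P v w h ρ u) (hM : 1 ≤ M) (hB : ∀ x, ‖B x‖ ≤ M)
    (ha : BoundedSymbol B v w s M a) :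
    h ^ 2 * ‖corr P v (twistD B v v s a) (covD P v u) (covD P w u) s +
      corr P v (twistD B v w s a) (covD P w u) (covD P w u) s‖ ≤
      5 * (|wedge v w| + 1) ^ 2 * M ^ 2 * (h + ρ / h) := by
  have hM0 : 0 ≤ M := zero_le_one.trans hM
  have hh := hu.h_pos
  have hρ := hu.error_nonneg
  have hu2 := hu.contDiff
  have hu1 := hu.contDiff_one
  have hue := hu.equivariant
  have hT := contDiff_transport (n := 2) hP hu2 v s
  have ha0 : ContDiff ℝ 1 a := ha.contDiff.of_le one_le_two
  have ha1 := fun w => contDiff_twistD (n := 2) (m := 1) hP ha.contDiff le_rfl v w s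
  have ha2 := fun w => (contDiff_twistD (n := 1) (m := 0) hP (ha1 w) le_rfl v w s).continuous
  have hd := fun v => (contDiff_covD (n := 2) (m := 1) hP hu2 le_rfl v).continuous
  have hde := fun v => hue.covD hP hu1 v
  have hr := continuous_lapOp hP hu2 v w (wedge v w) h
  have hre := hue.lapOp hP hu2 v w (wedge v w) h
  have nX := hu.nrm_covD_left_le hP
  have nY := hu.nrm_covD_right_le hP
  have nr := hu.nrm_lapOp_le
  have cB : Continuous fun x => (B x : ℂ) :=
    Complex.continuous_ofReal.comp (hP.contDiff_field 0).continuous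
  have hB' : ∀ x, ‖(B x : ℂ)‖ ≤ M := fun x => by simpa using hB x
  set r := lapOp P v w (wedge v w) h u with hrdef
  have hK : 1 ≤ |wedge v w| + 1 := by linarith [abs_nonneg (wedge v w)]
  set K := |wedge v w| + 1 with hKdef
  have hK0 : 0 ≤ K := zero_le_one.trans hK
  have hKh : 1 ≤ K / h := (one_le_div hh).2 (hu.h_le_one.trans hK)
  have cT : ∀ {f : Pt → ℂ}, Continuous f → Continuous (transport P v s f) := fun hf =>
    (contDiff_transport (n := 0) hP (contDiff_zero.2 hf) v s).continuous
  have t0 := cT hu2.continuous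
  have t1 := cT (hd v)
  have t2 := cT (hd w)
  have c0 := ha0.continuous
  have c1 := (ha1 v).continuous
  have c2 := (ha1 w).continuous
  have e1 := ip_covD_lapOp hP (ha.contDiff.mul hT) hu2
    ((hue.transport hP v s).mul ha.periodic) hue v w (wedge v w) h
  have e2 := ip_lapOp_mul_transport hP ha.contDiff hu2 (hd w) v w (wedge v w) h s
  rw [← hrdef] at e1 e2
  rw [e2, covD_mul_transport hP ha0 hu1, covD_mul_transport hP ha0 hu1,
    ip_add_left (by fun_prop) (by fun_prop) hr] at e1
  set F := ip (fun x => (B x : ℂ) * (a x * transport P v s u x)) (covD P v u) with hF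
  set G := ip (fun x => a x * transport P v s (covD P v u) x +
    twistD B v v s a x * transport P v s u x) (fun x => (B x : ℂ) * u x) with hG
  have e3 : 2 * ((h : ℂ) ^ 2 * (corr P v (twistD B v v s a) (covD P v u) (covD P w u) s +
      corr P v (twistD B v w s a) (covD P w u) (covD P w u) s)) =
      corr P v a (covD P w u) r s + corr P v (twistD B v w s a) u r s
      - corr P v a r (covD P w u) s - (h : ℂ) ^ 2 *
      (corr P v (twistD B v v s (twistD B v v s a)) u (covD P w u) s +
      corr P v (twistD B v w s (twistD B v w s a)) u (covD P w u) s +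
      Complex.I * wedge v w * (F + G)) := by
    unfold corr
    unfold corr at e1
    linear_combination -e1
  have b1 : ‖corr P v a (covD P w u) r s‖ ≤ M * (K / h) * ρ := by
    refine (norm_corr_le hP hM0 c0 ha.norm_le (hd w) (hde w) hr v s).trans ?_
    gcongr
    exact nrm_nonneg _
  have b2 : ‖corr P v (twistD B v w s a) u r s‖ ≤ M * (K / h) * ρ := by
    refine (norm_corr_le hP hM0 c2 ha.norm_right_le hu2.continuous hue hr v s).trans ?_
    rw [hu.nrm_eq_one]
    gcongr
    exact nrm_nonneg _
  have b3 : ‖corr P v a r (covD P w u) s‖ ≤ M * ρ * (K / h) := by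
    refine (norm_corr_le hP hM0 c0 ha.norm_le hr hre (hd w) v s).trans ?_
    gcongr
    exact nrm_nonneg _
  have b4 : ‖corr P v (twistD B v v s (twistD B v v s a)) u (covD P w u) s‖ ≤ M * 1 * (K / h) := by
    refine (norm_corr_le hP hM0 (ha2 v) ha.norm_left_left_le hu2.continuous hue
      (hd w) v s).trans ?_
    rw [hu.nrm_eq_one]
    gcongr
  have b5 : ‖corr P v (twistD B v w s (twistD B v w s a)) u (covD P w u) s‖ ≤ M * 1 * (K / h) := by
    refine (norm_corr_le hP hM0 (ha2 w) ha.norm_right_right_le hu2.continuous hue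
      (hd w) v s).trans ?_
    rw [hu.nrm_eq_one]
    gcongr
  have nT : ∀ {f : Pt → ℂ}, Continuous f → Equivariant Φ f → ∀ {c : Pt → ℂ}, Continuous c →
      (∀ x, ‖c x‖ ≤ M) → nrm (fun x => c x * transport P v s f x) ≤ M * nrm f :=
    fun hf he _ hc hcM => (nrm_mul_le hM0 hc (cT hf) hcM).trans_eq
      (by rw [nrm_transport hf he])
  have b6 : ‖F‖ ≤ M * (M * 1) * (K / h) := by
    refine (norm_ip_le (by fun_prop) (hd v)).trans ?_
    gcongr
    · exact nrm_nonneg _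
    · refine (nrm_mul_le hM0 cB (by fun_prop) hB').trans ?_
      gcongr
      exact (nT hu2.continuous hue c0 ha.norm_le).trans_eq (by rw [hu.nrm_eq_one])
  have b7 : ‖G‖ ≤ (M * (K / h) + M * 1) * (M * 1) := by
    have cu := hu2.continuous
    refine (norm_ip_le (by fun_prop) (by fun_prop)).trans ?_
    gcongr
    · exact nrm_nonneg _
    · refine (nrm_add_le (by fun_prop) (by fun_prop)).trans ?_
      gcongr
      · refine (nT (hd v) (hde v) c0 ha.norm_le).trans ?_
        gcongr
      · exact (nT hu2.continuous hue c1 ha.norm_left_le).trans_eq (by rw [hu.nrm_eq_one])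
    · exact (nrm_mul_le hM0 cB cu hB').trans_eq (by rw [hu.nrm_eq_one])
  have e4 := congrArg norm e3
  rw [norm_mul, norm_mul, norm_pow, Complex.norm_real, Complex.norm_ofNat, Real.norm_eq_abs,
    sq_abs] at e4
  have b8 : ‖corr P v (twistD B v v s (twistD B v v s a)) u (covD P w u) s +
      corr P v (twistD B v w s (twistD B v w s a)) u (covD P w u) s +
      Complex.I * wedge v w * (F + G)‖ ≤ 5 * K ^ 2 * M ^ 2 / h := by
    have n1 : ‖Complex.I * wedge v w * (F + G)‖ ≤ K * (3 * M ^ 2 * (K / h)) := by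
      rw [norm_mul, norm_mul, Complex.norm_I, one_mul, Complex.norm_real, Real.norm_eq_abs]
      have : ‖F + G‖ ≤ 3 * M ^ 2 * (K / h) := by
        refine (norm_add_le F G).trans ((add_le_add b6 b7).trans ?_)
        nlinarith [mul_le_mul_of_nonneg_left hKh (sq_nonneg M)]
      gcongr
      linarith
    refine (norm_add₃_le).trans ((add_le_add (add_le_add b4 b5) n1).trans ?_)
    have n2 : M * 1 * (K / h) ≤ K ^ 2 * M ^ 2 / h := by
      rw [mul_one, mul_div_assoc', mul_comm M K]
      gcongr <;> nlinarith
    have n3 : K * (3 * M ^ 2 * (K / h)) = 3 * (K ^ 2 * M ^ 2 / h) := by ring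
    rw [n3]
    refine (add_le_add (add_le_add n2 n2) le_rfl).trans_eq ?_
    ring
  have b9 : ‖corr P v a (covD P w u) r s + corr P v (twistD B v w s a) u r s
      - corr P v a r (covD P w u) s‖ ≤ 3 * K ^ 2 * M ^ 2 * (ρ / h) := by
    refine (norm_sub_le _ _).trans ((add_le_add ((norm_add_le _ _).trans
      (add_le_add b1 b2)) b3).trans ?_)
    have n1 : M * K ≤ K ^ 2 * M ^ 2 := by
      nlinarith [mul_nonneg hM0 hK0, one_le_mul_of_one_le_of_one_le hM hK]
    have n2 := mul_le_mul_of_nonneg_right n1 (div_nonneg hρ hh.le)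
    have n3 : M * (K / h) * ρ = M * K * (ρ / h) := by ring
    have n4 : M * ρ * (K / h) = M * K * (ρ / h) := by ring
    rw [n3, n4]
    linarith
  have b10 := norm_sub_le (corr P v a (covD P w u) r s + corr P v (twistD B v w s a) u r s
      - corr P v a r (covD P w u) s) ((h : ℂ) ^ 2 *
      (corr P v (twistD B v v s (twistD B v v s a)) u (covD P w u) s +
      corr P v (twistD B v w s (twistD B v w s a)) u (covD P w u) s +
      Complex.I * wedge v w * (F + G)))
  rw [norm_mul, norm_pow, Complex.norm_real, Real.norm_eq_abs, sq_abs] at b10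
  have b11 := mul_le_mul_of_nonneg_left b8 (sq_nonneg h)
  have n5 : h ^ 2 * (5 * K ^ 2 * M ^ 2 / h) = 5 * K ^ 2 * M ^ 2 * h := by
    field_simp
  have n6 : 0 ≤ K ^ 2 * M ^ 2 * (ρ / h) := by positivity
  have n7 : 0 ≤ K ^ 2 * M ^ 2 * h := by positivity
  rw [n5] at b11
  nlinarith

end IsQuasimode

end Quasimode

/-! ### Uniform bounds on symbols -/

theorem exists_bound_of_continuous_of_isPeriodic {E : Type*} [NormedAddCommGroup E]
    {F : ℝ → Pt → E} (hF : Continuous fun p : ℝ × Pt => F p.1 p.2) (hp : ∀ s, IsPeriodic (F s)) :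
    ∃ M, 0 ≤ M ∧ ∀ s, |s| ≤ 1 → ∀ x, ‖F s x‖ ≤ M := by
  obtain ⟨M, hM⟩ := ((isCompact_Icc (a := (-1 : ℝ)) (b := 1)).prod
    isCompact_fund).exists_bound_of_continuousOn hF.continuousOn
  refine ⟨max M 0, le_max_right _ _, fun s hs x => ?_⟩
  have h := hp s (-⌊x.1⌋, -⌊x.2⌋) x
  rw [← h]
  refine (hM (s, _) ⟨abs_le.1 hs, ?_⟩).trans (le_max_left _ _)
  simp only [fund, Set.mem_Icc, Prod.mk_le_mk, Int.cast_neg, ← sub_eq_add_neg]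
  have h1 := Int.floor_le x.1
  have h2 := Int.floor_le x.2
  have h3 := (Int.lt_floor_add_one x.1).le
  have h4 := (Int.lt_floor_add_one x.2).le
  exact ⟨⟨by linarith, by linarith⟩, ⟨by linarith, by linarith⟩⟩

theorem IsPeriodic.fderiv_apply {E : Type*} [NormedAddCommGroup E] [NormedSpace ℝ E] {f : Pt → E}
    (hp : IsPeriodic f) (v : Pt) : IsPeriodic fun x => _root_.fderiv ℝ f x v := fun m x => by
  beta_reduce
  rw [hp.fderiv m x]

theorem IsPeriodic.rayIntegral {G : Pt → ℝ} (hG : IsPeriodic G) (ψ : ℝ → ℝ) (v : Pt) (a b : ℝ) :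
    IsPeriodic (rayIntegral ψ G v a b) := fun m x => by
  change _root_.rayIntegral ψ G v a b (x + intVec m) = _
  unfold _root_.rayIntegral
  refine intervalIntegral.integral_congr fun t _ => ?_
  rw [add_right_comm, hG.add_intVec]

theorem IsPeriodic.ofReal {f : Pt → ℝ} (hf : IsPeriodic f) : IsPeriodic fun x => (f x : ℂ) :=
  fun m x => by beta_reduce; rw [hf m x]

theorem fderiv_ofReal {f : Pt → ℝ} (hf : Differentiable ℝ f) (x v : Pt) :
    fderiv ℝ (fun y => (f y : ℂ)) x v = (fderiv ℝ f x v : ℝ) := by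
  have h1 : HasFDerivAt (fun y => (f y : ℂ)) (Complex.ofRealCLM.comp (fderiv ℝ f x)) x :=
    Complex.ofRealCLM.hasFDerivAt.comp x (hf x).hasFDerivAt
  rw [h1.fderiv]
  rfl

section Symbols

variable {Φ : ℝ} {P : Pt → Pt} {B : Pt → ℝ}

theorem IsPeriodic.twistD (hB : IsPeriodic B) {a : Pt → ℂ} (ha : IsPeriodic a) (v w : Pt)
    (s : ℝ) : IsPeriodic (twistD B v w s a) := fun m x => by
  simp only [_root_.twistD, twist]
  rw [ha m x, ha.fderiv m x, hB.rayIntegral 1 v 0 s m x]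

theorem fderiv_twistD (hP : IsMagneticPotential Φ P B) {a : Pt → ℂ} (ha : ContDiff ℝ 2 a)
    (v w : Pt) (s : ℝ) (x : Pt) : fderiv ℝ (twistD B v w s a) x w =
      fderiv ℝ a x w * twist B v w s x +
      a x * (wedge v w * rayIntegral 1 (fun y => fderiv ℝ B y w) v 0 s x : ℝ) -
      Complex.I * fderiv ℝ (fun y => fderiv ℝ a y w) x w := by
  have h1 : Differentiable ℝ fun y => fderiv ℝ a y w :=
    ((ha.fderiv_right (m := 1) (by norm_num)).clm_apply contDiff_const).differentiable one_ne_zero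
  have h2 : Differentiable ℝ a := ha.differentiable two_ne_zero
  have h3 : Differentiable ℝ (rayIntegral 1 B v 0 s) :=
    (contDiff_rayIntegral_field hP 1 v s).differentiable one_ne_zero
  have h4 : Differentiable ℝ (twist B v w s) := h3.const_mul _
  have h5 : Differentiable ℝ fun x => (twist B v w s x : ℂ) :=
    (contDiff_twist hP 1 v w s).differentiable one_ne_zero
  have h6 := ((h2 x).hasFDerivAt.mul (h5 x).hasFDerivAt).sub
    ((h1 x).hasFDerivAt.const_mul Complex.I)
  unfold twistD
  erw [h6.fderiv]
  have h7 : fderiv ℝ (twist B v w s) x w =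
      wedge v w * rayIntegral 1 (fun y => fderiv ℝ B y w) v 0 s x := by
    rw [← fderiv_rayIntegral (ψ := 1) contDiff_const (hP.contDiff_field 1)]
    unfold twist
    erw [((h3 x).hasFDerivAt.const_mul (wedge v w)).fderiv]
    simp
  simp only [_root_.add_apply, _root_.sub_apply, _root_.smul_apply, smul_eq_mul,
    fderiv_ofReal h4, h7]
  ring

theorem continuous_twist (hP : IsMagneticPotential Φ P B) (v w : Pt) :
    Continuous fun p : ℝ × Pt => (twist B v w p.1 p.2 : ℂ) :=
  Complex.continuous_ofReal.comp (continuous_const.mul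
    (continuous_rayIntegral (ψ := 1) continuous_const (hP.contDiff_field 0).continuous v 0))

theorem continuous_twistD (hP : IsMagneticPotential Φ P B) {a : Pt → ℂ} (ha : ContDiff ℝ 1 a)
    (v w : Pt) : Continuous fun p : ℝ × Pt => twistD B v w p.1 a p.2 := by
  have h1 : Continuous fun x => fderiv ℝ a x w :=
    (ha.continuous_fderiv one_ne_zero).clm_apply continuous_const
  have h2 := ha.continuous
  have h3 := continuous_twist hP v w
  unfold twistD
  fun_prop

theorem continuous_twistD_twistD (hP : IsMagneticPotential Φ P B) {a : Pt → ℂ}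
    (ha : ContDiff ℝ 2 a) (v w : Pt) :
    Continuous fun p : ℝ × Pt => twistD B v w p.1 (twistD B v w p.1 a) p.2 := by
  have h0 := continuous_twistD hP (ha.of_le one_le_two) v w
  have h1 : ContDiff ℝ 1 fun x => fderiv ℝ a x w :=
    (ha.fderiv_right (m := 1) (by norm_num)).clm_apply contDiff_const
  have h2 : Continuous fun x => fderiv ℝ (fun y => fderiv ℝ a y w) x w :=
    (h1.continuous_fderiv one_ne_zero).clm_apply continuous_const
  have h3 := continuous_twist hP v w
  have h4 := h1.continuous
  have h5 := ha.continuous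
  have h6 : Continuous fun p : ℝ × Pt =>
      ((wedge v w * rayIntegral 1 (fun y => fderiv ℝ B y w) v 0 p.1 p.2 : ℝ) : ℂ) :=
    Complex.continuous_ofReal.comp (continuous_const.mul
      (continuous_rayIntegral (ψ := 1) continuous_const
        (((hP.contDiff_field 1).continuous_fderiv one_ne_zero).clm_apply continuous_const) v 0))
  have h7 : (fun p : ℝ × Pt => twistD B v w p.1 (twistD B v w p.1 a) p.2) = fun p =>
      twistD B v w p.1 a p.2 * twist B v w p.1 p.2 - Complex.I *
      (fderiv ℝ a p.2 w * twist B v w p.1 p.2 +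
      a p.2 * (wedge v w * rayIntegral 1 (fun y => fderiv ℝ B y w) v 0 p.1 p.2 : ℝ) -
      Complex.I * fderiv ℝ (fun y => fderiv ℝ a y w) p.2 w) := by
    funext p
    rw [twistD, fderiv_twistD hP ha]
  rw [h7]
  fun_prop

theorem BoundedSymbol.mono {v w : Pt} {s M M' : ℝ} {a : Pt → ℂ} (h : BoundedSymbol B v w s M a)
    (hM : M ≤ M') : BoundedSymbol B v w s M' a :=
  ⟨h.contDiff, h.periodic, fun x => (h.norm_le x).trans hM, fun x => (h.norm_left_le x).trans hM,
    fun x => (h.norm_right_le x).trans hM, fun x => (h.norm_left_left_le x).trans hM,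
    fun x => (h.norm_right_right_le x).trans hM⟩

theorem exists_boundedSymbol (hP : IsMagneticPotential Φ P B) {a : Pt → ℂ} (ha : ContDiff ℝ 2 a)
    (hp : IsPeriodic a) (v w : Pt) : ∃ M, ∀ s, |s| ≤ 1 → BoundedSymbol B v w s M a := by
  have hB := hP.periodic
  have ha1 := ha.of_le one_le_two
  obtain ⟨M₀, -, h₀⟩ := hp.exists_bound ha.continuous
  obtain ⟨M₁, -, h₁⟩ := exists_bound_of_continuous_of_isPeriodic (continuous_twistD hP ha1 v v)
    fun s => hB.twistD hp v v s
  obtain ⟨M₂, -, h₂⟩ := exists_bound_of_continuous_of_isPeriodic (continuous_twistD hP ha1 v w)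
    fun s => hB.twistD hp v w s
  obtain ⟨M₃, -, h₃⟩ := exists_bound_of_continuous_of_isPeriodic
    (continuous_twistD_twistD hP ha v v) fun s => hB.twistD (hB.twistD hp v v s) v v s
  obtain ⟨M₄, -, h₄⟩ := exists_bound_of_continuous_of_isPeriodic
    (continuous_twistD_twistD hP ha v w) fun s => hB.twistD (hB.twistD hp v w s) v w s
  refine ⟨max M₀ (max M₁ (max M₂ (max M₃ M₄))), fun s hs => ⟨ha, hp, ?_, ?_, ?_, ?_, ?_⟩⟩
  · exact fun x => (h₀ x).trans (by simp)
  · exact fun x => (h₁ s hs x).trans (by simp)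
  · exact fun x => (h₂ s hs x).trans (by simp)
  · exact fun x => (h₃ s hs x).trans (by simp)
  · exact fun x => (h₄ s hs x).trans (by simp)

theorem norm_integral_ray_sub_le {G : Pt → ℝ} (hG : ContDiff ℝ 1 G) {M : ℝ} {v : Pt}
    (hM : ∀ x, ‖fderiv ℝ G x v‖ ≤ M) (x : Pt) (t : ℝ) : ‖G (x + t • v) - G x‖ ≤ M * |t| := by
  have h := integral_fderiv_ray hG x v 0 t
  rw [zero_smul, add_zero] at h
  rw [← h]
  simpa using intervalIntegral.norm_integral_le_of_norm_le_const (a := 0) (b := t) (C := M)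
    (f := fun r : ℝ => fderiv ℝ G (x + r • v) v) fun r _ => hM _

theorem norm_twist_le {M : ℝ} (hM : ∀ x, ‖B x‖ ≤ M) (v w : Pt) (s : ℝ) (x : Pt) :
    ‖twist B v w s x‖ ≤ |wedge v w| * (M * |s|) := by
  rw [twist, norm_mul, Real.norm_eq_abs]
  gcongr
  simpa [rayIntegral] using intervalIntegral.norm_integral_le_of_norm_le_const
    (a := 0) (b := s) (C := M) (f := fun r : ℝ => B (x + r • v)) fun r _ => hM _

theorem norm_twist_sub_le (hB : ContDiff ℝ 1 B) {M : ℝ} {v : Pt}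
    (hM : ∀ x, ‖fderiv ℝ B x v‖ ≤ M) (w : Pt) (s : ℝ) (x : Pt) :
    ‖twist B v w s x - wedge v w * (s * B x)‖ ≤ |wedge v w| * (M * s ^ 2) := by
  have hM0 : 0 ≤ M := (norm_nonneg _).trans (hM x)
  rw [twist, ← mul_sub, norm_mul, Real.norm_eq_abs]
  gcongr
  have hc : Continuous fun t : ℝ => B (x + t • v) := hB.continuous.comp (by fun_prop)
  have h1 : rayIntegral 1 B v 0 s x - s * B x = ∫ t in (0 : ℝ)..s, (B (x + t • v) - B x) := by
    rw [intervalIntegral.integral_sub (hc.intervalIntegrable _ _) intervalIntegrable_const]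
    simp [rayIntegral]
  rw [h1]
  have h2 := intervalIntegral.norm_integral_le_of_norm_le_const (a := 0) (b := s) (C := M * |s|)
    (f := fun r : ℝ => B (x + r • v) - B x) fun r hr => by
      refine (norm_integral_ray_sub_le hB hM x r).trans ?_
      refine mul_le_mul_of_nonneg_left ?_ hM0
      have := Set.abs_sub_left_of_mem_uIcc (Set.uIoc_subset_uIcc hr)
      simpa using this
  refine h2.trans_eq ?_
  rw [sub_zero, mul_assoc, ← sq, sq_abs]

end Symbols

/-! ### The transported correlation of the averaged field -/

theorem correlation_error_le {n s M e : ℝ} (hn : 0 ≤ n) (hs : |s| ≤ 1) (hM : 1 ≤ M)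
    (he : 0 ≤ e) : 5 * (n + 1) ^ 2 * M ^ 2 * e + n * (M * s ^ 2) * (n + 1) ^ 2 +
      n * |s| * (5 * (n + 1) ^ 2 * M ^ 2 * e + M * (n * (M * |s|)) * (n + 1) ^ 2 +
        2 * M * (n + 1) * e) ≤ 12 * (n + 1) ^ 4 * M ^ 2 * (e + s ^ 2) := by
  have hs2 : |s| * |s| = s ^ 2 := by rw [← sq, sq_abs]
  have hK : 1 ≤ n + 1 := by linarith
  have hnK : n ≤ n + 1 := by linarith
  have hK0 : 0 ≤ n + 1 := by linarith
  have hM0 : 0 ≤ M := by linarith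
  generalize n + 1 = K at *
  have g1 : 5 * K ^ 2 * M ^ 2 * e ≤ 5 * (K ^ 4 * M ^ 2) * e := by
    rw [mul_assoc 5]; gcongr; norm_num
  have g2 : n * (M * s ^ 2) * K ^ 2 ≤ K ^ 4 * M ^ 2 * s ^ 2 := by
    calc n * (M * s ^ 2) * K ^ 2 = n * K ^ 2 * M * s ^ 2 := by ring
      _ ≤ K ^ 4 * M ^ 2 * s ^ 2 := by
        gcongr
        · calc n * K ^ 2 ≤ K ^ 2 * K ^ 2 := by gcongr; nlinarith
            _ = K ^ 4 := by ring
        · nlinarith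
  have g3 : n * |s| * (5 * K ^ 2 * M ^ 2 * e) ≤ 5 * (K ^ 4 * M ^ 2) * e := by
    calc n * |s| * (5 * K ^ 2 * M ^ 2 * e) ≤ K ^ 2 * 1 * (5 * K ^ 2 * M ^ 2 * e) := by
          gcongr; nlinarith
      _ = _ := by ring
  have g4 : n * |s| * (M * (n * (M * |s|)) * K ^ 2) ≤ K ^ 4 * M ^ 2 * s ^ 2 := by
    calc n * |s| * (M * (n * (M * |s|)) * K ^ 2) = n * n * K ^ 2 * M ^ 2 * (|s| * |s|) := by ring
      _ ≤ K * K * K ^ 2 * M ^ 2 * (|s| * |s|) := by gcongr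
      _ = _ := by rw [hs2]; ring
  have g5 : n * |s| * (2 * M * K * e) ≤ 2 * (K ^ 4 * M ^ 2) * e := by
    calc n * |s| * (2 * M * K * e) ≤ K * 1 * (2 * M ^ 2 * K * e) := by
          gcongr; nlinarith
      _ = 2 * (K ^ 2 * M ^ 2) * e := by ring
      _ ≤ _ := by gcongr; norm_num
  have g6 : 0 ≤ K ^ 4 * M ^ 2 * s ^ 2 := by positivity
  linarith

section Correlation

variable {Φ : ℝ} {P : Pt → Pt} {B : Pt → ℝ} {v w : Pt} {h ρ : ℝ} {u : Pt → ℂ}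

theorem corr_add_mul (hP : IsMagneticPotential Φ P B) {a b f g : Pt → ℂ} (ha : Continuous a)
    (hb : Continuous b) (hf : Continuous f) (hg : Continuous g) (c : ℂ) (v : Pt) (s : ℝ) :
    corr P v (fun x => a x + c * b x) f g s = corr P v a f g s + c * corr P v b f g s := by
  have hT : Continuous (transport P v s f) :=
    (contDiff_transport (n := 0) hP (contDiff_zero.2 hf) v s).continuous
  unfold corr
  rw [← ip_const_mul_left, ← ip_add_left (by fun_prop) (by fun_prop) hg]
  congr 1
  funext x
  ring

namespace IsQuasimode

theorem norm_corr_left_left_le (hP : IsMagneticPotential Φ P B)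
    (hu : IsQuasimode Φ P v w h ρ u) {a : Pt → ℂ} {M : ℝ} (hM : 0 ≤ M) (ha : Continuous a)
    (haM : ∀ x, ‖a x‖ ≤ M) (s : ℝ) :
    h ^ 2 * ‖corr P v a (covD P w u) (covD P w u) s‖ ≤ M * (|wedge v w| + 1) ^ 2 := by
  have hd := (contDiff_covD (n := 2) (m := 1) hP hu.contDiff le_rfl w).continuous
  have h1 := norm_corr_le hP hM ha haM hd (hu.equivariant.covD hP hu.contDiff_one w) hd v s
  have h2 := hu.mul_nrm_covD_right_le hP
  have h3 : 0 ≤ h * nrm (covD P w u) := mul_nonneg hu.h_pos.le (nrm_nonneg _)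
  calc _ ≤ h ^ 2 * (M * nrm (covD P w u) * nrm (covD P w u)) := by gcongr
    _ = M * (h * nrm (covD P w u)) ^ 2 := by ring
    _ ≤ _ := by gcongr

theorem abs_mul_norm_corr_sub_le (hP : IsMagneticPotential Φ P B)
    (hu : IsQuasimode Φ P v w h ρ u) {b g : Pt → ℝ} (hbg : ∀ x, B x = b x + fderiv ℝ g x w)
    (hgd : ContDiff ℝ 2 g) {s M : ℝ} (hs : |s| ≤ 1) (hM : 1 ≤ M) (hB : ∀ x, ‖B x‖ ≤ M)
    (hB' : ∀ x, ‖fderiv ℝ B x v‖ ≤ M) (h1 : BoundedSymbol B v w s M 1)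
    (hb : BoundedSymbol B v w s M fun x => b x) (hg : BoundedSymbol B v w s M fun x => g x) :
    |wedge v w| * |s| * ‖wedge v w * corr P v (fun x => b x) u u s - (h : ℂ) ^ 2 *
      (corr P v (fun x => b x) (covD P v u) (covD P v u) s +
        corr P v (fun x => fderiv ℝ g x v) (covD P v u) (covD P w u) s)‖ ≤
      12 * (|wedge v w| + 1) ^ 4 * M ^ 2 * (h + ρ / h + s ^ 2) := by
  have hM0 : 0 ≤ M := zero_le_one.trans hM
  have hh := hu.h_pos
  have hρ := hu.error_nonneg
  have hu2 := hu.contDiff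
  have hu1 := hu.contDiff_one
  have hue := hu.equivariant
  have hd := fun v => contDiff_covD (n := 2) (m := 1) hP hu2 le_rfl v
  have hdc := fun v => (hd v).continuous
  have hde := fun v => hue.covD hP hu1 v
  have nX := hu.nrm_covD_left_le hP
  have nY := hu.nrm_covD_right_le hP
  have cr := continuous_lapOp hP hu2 v w (wedge v w) h
  have cu := hu2.continuous
  have cb := hb.contDiff.continuous
  have cg := hg.contDiff.continuous
  have cdg : ∀ v, Continuous fun x => (fderiv ℝ g x v : ℂ) := fun v =>
    Complex.continuous_ofReal.comp
      ((hgd.continuous_fderiv two_ne_zero).clm_apply continuous_const)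
  have cB : Continuous fun x => (B x : ℂ) :=
    Complex.continuous_ofReal.comp (hP.contDiff_field 0).continuous
  have ct := (contDiff_twist hP 0 v w s).continuous
  have hgdd : Differentiable ℝ g := hgd.differentiable two_ne_zero
  set r := lapOp P v w (wedge v w) h u with hrdef
  set n := |wedge v w| with hn
  have hn0 : 0 ≤ n := abs_nonneg _
  set J := corr P v (fun x => b x) u u s with hJ
  set bXX := corr P v (fun x => b x) (covD P v u) (covD P v u) s with hbXX
  set bYY := corr P v (fun x => b x) (covD P w u) (covD P w u) s with hbYY
  set gv := corr P v (fun x => fderiv ℝ g x v) (covD P v u) (covD P w u) s with hgv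
  set gw := corr P v (fun x => fderiv ℝ g x w) (covD P w u) (covD P w u) s with hgw
  set RR := corr P v (fun x => twist B v w s x - wedge v w * (s * B x)) (covD P w u)
    (covD P w u) s with hRR
  set GT := corr P v (fun x => g x * twist B v w s x) (covD P w u) (covD P w u) s with hGT
  set e := h + ρ / h with he
  have he0 : 0 ≤ e := by positivity
  have q1 := hu.norm_corr_covD_add_corr_covD_le hP hM hB h1
  have q2 := hu.norm_corr_covD_add_corr_covD_le hP hM hB hg
  have E1 : corr P v (twistD B v v s 1) (covD P v u) (covD P w u) s +
      corr P v (twistD B v w s 1) (covD P w u) (covD P w u) s =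
      wedge v w * s * (bYY + gw) + RR := by
    have z1 : twistD B v v s 1 = fun _ => 0 := by
      funext x
      simp [twistD, twist_self]
    have z2 : twistD B v w s 1 = fun x => (twist B v w s x - wedge v w * (s * B x)) +
        (wedge v w * s) * ((b x : ℂ) + 1 * (fderiv ℝ g x w : ℂ)) := by
      funext x
      simp [twistD, hbg x]
      ring
    have z3 : corr P v (fun _ => 0) (covD P v u) (covD P w u) s = 0 := by simp [corr, ip]
    have := cdg w
    rw [z1, z2, z3, corr_add_mul hP (by fun_prop) (by fun_prop) (hdc w) (hdc w),
      corr_add_mul hP cb (cdg w) (hdc w) (hdc w)]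
    ring
  have E2 : corr P v (twistD B v v s fun x => g x) (covD P v u) (covD P w u) s +
      corr P v (twistD B v w s fun x => g x) (covD P w u) (covD P w u) s =
      -Complex.I * gv + GT - Complex.I * gw := by
    have z1 : twistD B v v s (fun x => g x) = fun x => 0 + -Complex.I * (fderiv ℝ g x v : ℂ) := by
      funext x
      simp [twistD, twist_self, fderiv_ofReal hgdd]
    have z2 : twistD B v w s (fun x => g x) = fun x => (g x * twist B v w s x) +
        -Complex.I * (fderiv ℝ g x w : ℂ) := by
      funext x
      rw [twistD, fderiv_ofReal hgdd]
      ring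
    have z3 : corr P v (fun _ => 0) (covD P v u) (covD P w u) s = 0 := by simp [corr, ip]
    rw [z1, z2, corr_add_mul hP continuous_const (cdg v) (hdc v) (hdc w), z3,
      corr_add_mul hP (by fun_prop) (cdg w) (hdc w) (hdc w)]
    ring
  have E3 : (h : ℂ) ^ 2 * bYY = wedge v w * J - (h : ℂ) ^ 2 * bXX +
      (corr P v (fun x => b x) u r s - (h : ℂ) ^ 2 *
      (corr P v (twistD B v v s fun x => b x) u (covD P v u) s +
        corr P v (twistD B v w s fun x => b x) u (covD P w u) s)) := by
    have hbd1 := hb.contDiff.of_le one_le_two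
    have hT1 := contDiff_transport (n := 1) hP hu1 v s
    have hTd := fun w => (contDiff_transport (n := 1) hP (hd w) v s).continuous
    have hTc := hT1.continuous
    have key : ∀ w, ip (fun x => (b x : ℂ) * transport P v s u x) (covD P w (covD P w u)) =
        corr P v (fun x => b x) (covD P w u) (covD P w u) s +
        corr P v (twistD B v w s fun x => b x) u (covD P w u) s := fun w => by
      have c1 := (contDiff_twistD (n := 1) (m := 0) hP hbd1 le_rfl v w s).continuous
      have c2 := hTd w
      rw [← ip_covD hP (hbd1.mul hT1) (hd w) ((hue.transport hP v s).mul hb.periodic) (hde w),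
        covD_mul_transport hP hbd1 hu1, ip_add_left (by fun_prop) (by fun_prop) (hdc w)]
      rfl
    have := ip_lapOp_right hP (f := fun x => (b x : ℂ) * transport P v s u x) (by fun_prop) hu2
      v w (wedge v w) h
    rw [key, key] at this
    change corr P v (fun x => b x) u r s = _ at this
    rw [this]
    simp only [hbYY, hJ, hbXX]
    unfold corr
    ring
  rw [E1] at q1
  rw [E2] at q2
  have b1 : h ^ 2 * ‖RR‖ ≤ n * (M * s ^ 2) * (n + 1) ^ 2 := by
    refine hu.norm_corr_left_left_le hP (by positivity) (by fun_prop) (fun x => ?_) s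
    have := norm_twist_sub_le (hP.contDiff_field 1) hB' w s x
    rw [← Complex.norm_real] at this
    simpa using this
  have b2 : h ^ 2 * ‖GT‖ ≤ M * (n * (M * |s|)) * (n + 1) ^ 2 := by
    refine hu.norm_corr_left_left_le hP (by positivity) (by fun_prop) (fun x => ?_) s
    rw [norm_mul]
    gcongr
    · exact hg.norm_le x
    · have := norm_twist_le hB v w s x
      rwa [← Complex.norm_real] at this
  have b3 : ‖corr P v (fun x => b x) u r s - (h : ℂ) ^ 2 *
      (corr P v (twistD B v v s fun x => b x) u (covD P v u) s +
        corr P v (twistD B v w s fun x => b x) u (covD P w u) s)‖ ≤ 2 * M * (n + 1) * e := by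
    have c1 : ‖corr P v (fun x => b x) u r s‖ ≤ M * ρ := by
      refine (norm_corr_le hP hM0 cb hb.norm_le cu hue cr v s).trans ?_
      rw [hu.nrm_eq_one, mul_one]
      gcongr
      exact hu.nrm_lapOp_le
    have hbt := fun w => (contDiff_twistD (n := 2) (m := 1) hP hb.contDiff le_rfl v w s).continuous
    have c2 : ‖corr P v (twistD B v v s fun x => b x) u (covD P v u) s‖ ≤ M * ((n + 1) / h) := by
      refine (norm_corr_le hP hM0 (hbt v) hb.norm_left_le cu hue (hdc v) v s).trans ?_
      rw [hu.nrm_eq_one, mul_one]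
      gcongr
    have c3 : ‖corr P v (twistD B v w s fun x => b x) u (covD P w u) s‖ ≤ M * ((n + 1) / h) := by
      refine (norm_corr_le hP hM0 (hbt w) hb.norm_right_le cu hue (hdc w) v s).trans ?_
      rw [hu.nrm_eq_one, mul_one]
      gcongr
    refine (norm_sub_le _ _).trans ?_
    rw [norm_mul, norm_pow, Complex.norm_real, Real.norm_eq_abs, sq_abs]
    have c4 := mul_le_mul_of_nonneg_left ((norm_add_le _ _).trans (add_le_add c2 c3)) (sq_nonneg h)
    have c5 : h ^ 2 * (M * ((n + 1) / h) + M * ((n + 1) / h)) = 2 * M * (n + 1) * h := by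
      field_simp; ring
    have c6 : ρ ≤ ρ / h := (le_div_iff₀ hh).2 (by nlinarith [hu.h_le_one])
    rw [c5] at c4
    have c7 : M * ρ ≤ 2 * M * (n + 1) * (ρ / h) := by
      have : M * (ρ / h) * 1 ≤ M * (ρ / h) * (2 * (n + 1)) := by gcongr; linarith
      nlinarith
    have c8 : 2 * M * (n + 1) * e = 2 * M * (n + 1) * h + 2 * M * (n + 1) * (ρ / h) := by
      rw [he]; ring
    linarith
  set err := corr P v (fun x => b x) u r s - (h : ℂ) ^ 2 *
      (corr P v (twistD B v v s fun x => b x) u (covD P v u) s +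
        corr P v (twistD B v w s fun x => b x) u (covD P w u) s) with herr
  have E4 : (wedge v w : ℂ) * s * (wedge v w * J - (h : ℂ) ^ 2 * (bXX + gv)) =
      (h : ℂ) ^ 2 * (wedge v w * s * (bYY + gw) + RR) - (h : ℂ) ^ 2 * RR -
      wedge v w * s * (Complex.I * ((h : ℂ) ^ 2 * (-Complex.I * gv + GT - Complex.I * gw) -
        (h : ℂ) ^ 2 * GT) + err) := by
    linear_combination (-(wedge v w : ℂ) * s) * E3 -
      (wedge v w : ℂ) * s * (h : ℂ) ^ 2 * (gv + gw) * Complex.I_sq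
  have nh : ‖(h : ℂ) ^ 2‖ = h ^ 2 := by
    rw [norm_pow, Complex.norm_real, Real.norm_eq_abs, sq_abs]
  have nws : ‖(wedge v w : ℂ) * s‖ = n * |s| := by
    rw [norm_mul, Complex.norm_real, Complex.norm_real]; rfl
  have E5 := congrArg norm E4
  rw [norm_mul, nws] at E5
  rw [E5]
  have q1' : ‖(h : ℂ) ^ 2 * (wedge v w * s * (bYY + gw) + RR)‖ ≤ 5 * (n + 1) ^ 2 * M ^ 2 * e := by
    rw [norm_mul, nh]; exact q1
  have q2' : ‖(h : ℂ) ^ 2 * (-Complex.I * gv + GT - Complex.I * gw)‖ ≤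
      5 * (n + 1) ^ 2 * M ^ 2 * e := by
    rw [norm_mul, nh]; exact q2
  have b1' : ‖(h : ℂ) ^ 2 * RR‖ ≤ n * (M * s ^ 2) * (n + 1) ^ 2 := by
    rw [norm_mul, nh]; exact b1
  have b2' : ‖(h : ℂ) ^ 2 * GT‖ ≤ M * (n * (M * |s|)) * (n + 1) ^ 2 := by
    rw [norm_mul, nh]; exact b2
  have F1 : ‖Complex.I * ((h : ℂ) ^ 2 * (-Complex.I * gv + GT - Complex.I * gw) -
        (h : ℂ) ^ 2 * GT) + err‖ ≤ 5 * (n + 1) ^ 2 * M ^ 2 * e +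
        M * (n * (M * |s|)) * (n + 1) ^ 2 + 2 * M * (n + 1) * e := by
    refine (norm_add_le _ _).trans (add_le_add ?_ b3)
    rw [norm_mul, Complex.norm_I, one_mul]
    exact (norm_sub_le _ _).trans (add_le_add q2' b2')
  have F2 : ‖(wedge v w : ℂ) * s * (Complex.I * ((h : ℂ) ^ 2 * (-Complex.I * gv + GT -
      Complex.I * gw) - (h : ℂ) ^ 2 * GT) + err)‖ ≤ n * |s| * (5 * (n + 1) ^ 2 * M ^ 2 * e +
        M * (n * (M * |s|)) * (n + 1) ^ 2 + 2 * M * (n + 1) * e) := by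
    rw [norm_mul, nws]
    gcongr
  refine (norm_sub_le _ _).trans ((add_le_add ((norm_sub_le _ _).trans
    (add_le_add q1' b1')) F2).trans ?_)
  exact correlation_error_le hn0 hs hM he0

end IsQuasimode

end Correlation

/-! ### Smallness of averages along the transport flow -/

theorem exists_pos_le_or_le_neg {b : Pt → ℝ} (hb : Continuous b) (hp : IsPeriodic b)
    (h0 : ∀ x, b x ≠ 0) : ∃ c, 0 < c ∧ ((∀ x, c ≤ b x) ∨ ∀ x, b x ≤ -c) := by
  have hpi : IsPeriodic fun x => (b x)⁻¹ := fun m x => by beta_reduce; rw [hp m x]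
  obtain ⟨M, hM, hbM⟩ := hpi.exists_bound (hb.inv₀ h0)
  have hM1 : 0 < M + 1 := by linarith
  have habs : ∀ x, (M + 1)⁻¹ ≤ |b x| := fun x => by
    have h1 := hbM x
    rw [norm_inv, Real.norm_eq_abs] at h1
    have h2 : 0 < |b x| := abs_pos.2 (h0 x)
    exact inv_le_of_inv_le₀ h2 (h1.trans (by linarith))
  refine ⟨(M + 1)⁻¹, inv_pos.2 hM1, ?_⟩
  by_cases h : ∀ x, 0 ≤ b x
  · exact Or.inl fun x => by simpa [abs_of_nonneg (h x)] using habs x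
  · right
    push Not at h
    obtain ⟨y, hy⟩ := h
    intro x
    have hx : b x < 0 := by
      by_contra! hx
      obtain ⟨z, hz⟩ := mem_range_of_exists_le_of_exists_ge hb ⟨y, hy.le⟩ ⟨x, hx⟩
      exact h0 z hz
    have := habs x
    rw [abs_of_neg hx] at this
    linarith

theorem mul_nrm_sq_le_norm_ip {b : Pt → ℝ} (hb : Continuous b) {c : ℝ}
    (hc : (∀ x, c ≤ b x) ∨ ∀ x, b x ≤ -c) {f : Pt → ℂ} (hf : Continuous f) :
    c * nrm f ^ 2 ≤ ‖ip (fun x => (b x : ℂ) * f x) f‖ := by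
  have h1 : ip (fun x => (b x : ℂ) * f x) f = ((∫ x in fund, b x * ‖f x‖ ^ 2 : ℝ) : ℂ) := by
    rw [ip, ← integral_complex_ofReal]
    refine integral_congr_ae (Eventually.of_forall fun x => ?_)
    simp [mul_assoc, Complex.mul_conj, Complex.normSq_eq_norm_sq]
  rw [h1, Complex.norm_real, nrm_sq, Real.norm_eq_abs, ← integral_const_mul]
  rcases hc with hc | hc
  · refine le_trans ?_ (le_abs_self _)
    exact integral_mono (Continuous.integrableOn_fund (by fun_prop))
      (Continuous.integrableOn_fund (by fun_prop)) fun x => by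
        beta_reduce; gcongr; exact hc x
  · refine le_trans ?_ (neg_le_abs _)
    rw [← integral_neg]
    refine integral_mono (Continuous.integrableOn_fund (by fun_prop))
      (Continuous.integrableOn_fund (by fun_prop)) fun x => ?_
    have := mul_le_mul_of_nonneg_right (hc x) (sq_nonneg ‖f x‖)
    beta_reduce
    linarith

section Averages

variable {Φ : ℝ} {P : Pt → Pt} {B : Pt → ℝ} {v w : Pt}

theorem corr_transport_right (hP : IsMagneticPotential Φ P B) {a f g : Pt → ℂ}
    (ha : Continuous a) (hap : IsPeriodic a) (hf : Continuous f) (hfe : Equivariant Φ f)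
    (hg : Continuous g) (hge : Equivariant Φ g) (v : Pt) (s t : ℝ) :
    corr P v a f (transport P v t g) s =
      corr P v (fun x => a (x + (-t) • v)) f g (s - t) := by
  have cT : ∀ {f : Pt → ℂ}, Continuous f → ∀ s, Continuous (transport P v s f) := fun hf s =>
    (contDiff_transport (n := 0) hP (contDiff_zero.2 hf) v s).continuous
  have c1 := cT hf s
  have c2 := cT hg t
  have hper : IsPeriodic fun x => a x * transport P v s f x * conj (transport P v t g x) :=
    ((hfe.transport hP v s).mul hap).isPeriodic_mul_conj (hge.transport hP v t)
  unfold corr ip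
  rw [← setIntegral_fund_add (by fun_prop) hper ((-t) • v)]
  congr 1
  funext x
  rw [mul_assoc, transport_mul_conj_transport hP, mul_assoc]

namespace IsQuasimode

theorem exists_abs_mul_norm_corr_sub_le (hP : IsMagneticPotential Φ P B) (hN : wedge v w ≠ 0)
    {b g : Pt → ℝ} (hb : ContDiff ℝ 2 b) (hbp : IsPeriodic b) (hg : ContDiff ℝ 2 g)
    (hgp : IsPeriodic g) (hbg : ∀ x, B x = b x + fderiv ℝ g x w) :
    ∃ C, 0 ≤ C ∧ ∀ (h ρ : ℝ) (u : Pt → ℂ), IsQuasimode Φ P v w h ρ u → ∀ s, |s| ≤ 1 →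
      |s| * ‖wedge v w * corr P v (fun x => b x) u u s - (h : ℂ) ^ 2 *
        (corr P v (fun x => b x) (covD P v u) (covD P v u) s +
          corr P v (fun x => fderiv ℝ g x v) (covD P v u) (covD P w u) s)‖ ≤
        C * (h + ρ / h + s ^ 2) := by
  obtain ⟨M₁, -, h₁⟩ := hP.periodic.exists_bound (hP.contDiff_field 0).continuous
  obtain ⟨M₂, -, h₂⟩ := (hP.periodic.fderiv_apply v).exists_bound
    (((hP.contDiff_field 1).continuous_fderiv one_ne_zero).clm_apply continuous_const)
  obtain ⟨M₃, h₃⟩ := exists_boundedSymbol hP (a := 1) contDiff_const (fun _ _ => rfl) v w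
  obtain ⟨M₄, h₄⟩ := exists_boundedSymbol hP (Complex.ofRealCLM.contDiff.comp hb) hbp.ofReal v w
  obtain ⟨M₅, h₅⟩ := exists_boundedSymbol hP (Complex.ofRealCLM.contDiff.comp hg) hgp.ofReal v w
  set M := max 1 (max M₁ (max M₂ (max M₃ (max M₄ M₅)))) with hM
  have k0 : 1 ≤ M := by simp [hM]
  have k1 : M₁ ≤ M := by simp [hM]
  have k2 : M₂ ≤ M := by simp [hM]
  have k3 : M₃ ≤ M := by simp [hM]
  have k4 : M₄ ≤ M := by simp [hM]
  have k5 : M₅ ≤ M := by simp [hM]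
  have hN' : 0 < |wedge v w| := abs_pos.2 hN
  refine ⟨12 * (|wedge v w| + 1) ^ 4 * M ^ 2 / |wedge v w|, by positivity,
    fun h ρ u hu s hs => ?_⟩
  have := hu.abs_mul_norm_corr_sub_le hP hbg hg hs k0 (fun x => (h₁ x).trans k1)
    (fun x => (h₂ x).trans k2) ((h₃ s hs).mono k3) ((h₄ s hs).mono k4) ((h₅ s hs).mono k5)
  rw [div_mul_eq_mul_div, le_div_iff₀' hN', ← mul_assoc]
  exact this

theorem exists_norm_integral_corr_le (hP : IsMagneticPotential Φ P B) (hN : wedge v w ≠ 0)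
    {b g : Pt → ℝ} (hb : ContDiff ℝ 2 b) (hbp : IsPeriodic b) (hg : ContDiff ℝ 2 g)
    (hgp : IsPeriodic g) (hbg : ∀ x, B x = b x + fderiv ℝ g x w) :
    ∃ C, 0 ≤ C ∧ ∀ (q ρ : ℝ) (u : Pt → ℂ), 0 < q → q ≤ 1 → IsQuasimode Φ P v w (q ^ 2) ρ u →
      ∀ δ, 0 < δ → δ ≤ 1 → ∀ t, |t| ≤ q →
      ‖∫ s in (0 : ℝ)..t, corr P v (fun x => b x) u u s‖ ≤
        C * q * (δ + (q + ρ / q ^ 3) / δ) := by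
  obtain ⟨C, hC, hCb⟩ := exists_abs_mul_norm_corr_sub_le hP hN hb hbp hg hgp hbg
  obtain ⟨M, hM, hbM⟩ := hbp.exists_bound hb.continuous
  obtain ⟨M', hM', hgM⟩ := (hgp.fderiv_apply v).exists_bound
    ((hg.continuous_fderiv two_ne_zero).clm_apply continuous_const)
  have hN' : 0 < |wedge v w| := abs_pos.2 hN
  refine ⟨M + (2 * C + 2 * (M + M') * (|wedge v w| + 1)) / |wedge v w|, by positivity,
    fun q ρ u hq hq1 hu δ hδ hδ1 t ht => ?_⟩
  have hu2 := hu.contDiff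
  have hu1 := hu.contDiff_one
  have hue := hu.equivariant
  have hdc := fun v => (contDiff_covD (n := 2) (m := 1) hP hu2 le_rfl v).continuous
  have nX := hu.nrm_covD_left_le hP
  have nY := hu.nrm_covD_right_le hP
  have hρ := hu.error_nonneg
  have cu := hu2.continuous
  have cb : Continuous fun x => (b x : ℂ) := Complex.continuous_ofReal.comp hb.continuous
  have cg : Continuous fun x => (fderiv ℝ g x v : ℂ) := Complex.continuous_ofReal.comp
    ((hg.continuous_fderiv two_ne_zero).clm_apply continuous_const)
  have hbM' : ∀ x, ‖(b x : ℂ)‖ ≤ M := fun x => by simpa using hbM x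
  have hgM'' : ∀ x, ‖(fderiv ℝ g x v : ℂ)‖ ≤ M' := fun x => by
    rw [Complex.norm_real]; exact hgM x
  set η := q + ρ / q ^ 3 with hη
  have hη0 : 0 < η := by positivity
  have hqη : q ≤ η := by rw [hη]; linarith [show 0 ≤ ρ / q ^ 3 by positivity]
  set J := corr P v (fun x => b x) u u with hJ
  set K := |wedge v w| + 1 with hK
  have hK0 : 0 < K := by positivity
  have cJ : Continuous J := continuous_corr hP cb cu cu v
  have cX := continuous_corr hP cb (hdc v) (hdc v) v
  have cY := continuous_corr hP cg (hdc v) (hdc w) v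
  set X := corr P v (fun x => b x) (covD P v u) (covD P v u)
  set Y := corr P v (fun x => fderiv ℝ g x v) (covD P v u) (covD P w u)
  have hJM : ∀ s, ‖J s‖ ≤ M := fun s => hu.norm_corr_self_le hP hM cb hbM' s
  have i1 : ‖∫ s in (0 : ℝ)..δ * t, J s‖ ≤ M * (q * δ) := by
    refine (intervalIntegral.norm_integral_le_of_norm_le_const fun s _ => hJM s).trans ?_
    rw [sub_zero, abs_mul, abs_of_pos hδ, mul_comm δ]
    gcongr
  have i2 : ‖∫ s in δ * t..t, (wedge v w * J s - ((q ^ 2 : ℝ) : ℂ) ^ 2 * (X s + Y s))‖ ≤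
      2 * C * (q * (η / δ)) := by
    have hbd : ∀ s ∈ Set.uIoc (δ * t) t,
        ‖wedge v w * J s - ((q ^ 2 : ℝ) : ℂ) ^ 2 * (X s + Y s)‖ ≤
        2 * C * (q * (η / δ)) / |t| := by
      intro s hs
      have hs' : δ * |t| ≤ |s| ∧ |s| ≤ |t| ∧ 0 < |t| := by
        rcases le_total 0 t with h0 | h0
        · rw [Set.uIoc_of_le (by nlinarith), Set.mem_Ioc] at hs
          have : 0 ≤ δ * t := by positivity
          rw [abs_of_nonneg h0, abs_of_pos (by linarith)]
          exact ⟨hs.1.le, hs.2, by linarith⟩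
        · rw [Set.uIoc_of_ge (by nlinarith), Set.mem_Ioc] at hs
          have : δ * t ≤ 0 := mul_nonpos_of_nonneg_of_nonpos hδ.le h0
          rw [abs_of_nonpos h0, abs_of_nonpos (by linarith)]
          exact ⟨by linarith, by linarith, by linarith⟩
      obtain ⟨h1, h2, h3⟩ := hs'
      have h4 := hCb (q ^ 2) ρ u hu s ((h2.trans ht).trans hq1)
      have h5 : q ^ 2 + ρ / q ^ 2 + s ^ 2 ≤ 2 * (q * η) := by
        have : s ^ 2 ≤ q ^ 2 := sq_le_sq.2 (by rw [abs_of_pos hq]; exact h2.trans ht)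
        have h6 : q * η = q ^ 2 + ρ / q ^ 2 := by rw [hη]; field_simp
        have h7 : q ^ 2 ≤ q * η := by nlinarith
        linarith
      rw [le_div_iff₀ h3, ← mul_div_assoc, ← mul_div_assoc, le_div_iff₀ hδ]
      calc _ = (δ * |t|) * ‖wedge v w * J s - ((q ^ 2 : ℝ) : ℂ) ^ 2 * (X s + Y s)‖ := by ring
        _ ≤ |s| * ‖wedge v w * J s - ((q ^ 2 : ℝ) : ℂ) ^ 2 * (X s + Y s)‖ := by gcongr
        _ ≤ C * (q ^ 2 + ρ / q ^ 2 + s ^ 2) := h4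
        _ ≤ C * (2 * (q * η)) := by gcongr
        _ = _ := by ring
    refine (intervalIntegral.norm_integral_le_of_norm_le_const hbd).trans ?_
    have h1 : |t - δ * t| ≤ |t| := by
      rw [show t - δ * t = (1 - δ) * t by ring, abs_mul, abs_of_nonneg (by linarith)]
      exact mul_le_of_le_one_left (abs_nonneg t) (by linarith)
    rcases eq_or_ne t 0 with rfl | h0
    · simp; positivity
    · rw [div_mul_eq_mul_div, div_le_iff₀ (abs_pos.2 h0)]
      gcongr
  have i3 : ‖∫ s in δ * t..t, (X s + Y s)‖ ≤ 2 * ((M + M') * (K / q ^ 2)) := by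
    rw [intervalIntegral.integral_add (cX.intervalIntegrable _ _) (cY.intervalIntegrable _ _),
      integral_corr_covD hP cb hu1 (hdc v), integral_corr_covD hP cg hu1 (hdc w)]
    have a1 : ∀ s, ‖corr P v (fun x => b x) u (covD P v u) s‖ ≤ M * (K / q ^ 2) := fun s => by
      refine (norm_corr_le hP hM cb hbM' cu hue (hdc v) v s).trans ?_
      rw [hu.nrm_eq_one, mul_one]
      gcongr
    have a2 : ∀ s, ‖corr P v (fun x => fderiv ℝ g x v) u (covD P w u) s‖ ≤ M' * (K / q ^ 2) :=
      fun s => by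
      refine (norm_corr_le hP hM' cg hgM'' cu hue (hdc w) v s).trans ?_
      rw [hu.nrm_eq_one, mul_one]
      gcongr
    refine (norm_add_le _ _).trans ?_
    rw [norm_mul, norm_mul, norm_neg, Complex.norm_I, one_mul, one_mul]
    have := norm_sub_le_of_le (a1 t) (a1 (δ * t))
    have := norm_sub_le_of_le (a2 t) (a2 (δ * t))
    linarith
  have i4 : |wedge v w| * ‖∫ s in δ * t..t, J s‖ ≤
      (2 * C + 2 * (M + M') * K) * (q * (η / δ)) := by
    have e1 : (wedge v w : ℂ) * ∫ s in δ * t..t, J s =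
        (∫ s in δ * t..t, (wedge v w * J s - ((q ^ 2 : ℝ) : ℂ) ^ 2 * (X s + Y s))) +
        ((q ^ 2 : ℝ) : ℂ) ^ 2 * ∫ s in δ * t..t, (X s + Y s) := by
      rw [← intervalIntegral.integral_const_mul, ← intervalIntegral.integral_const_mul,
        ← intervalIntegral.integral_add
          (Continuous.intervalIntegrable (by fun_prop) _ _)
          (Continuous.intervalIntegrable (by fun_prop) _ _)]
      simp
    have e2 := congrArg norm e1
    rw [norm_mul, Complex.norm_real, Real.norm_eq_abs] at e2
    rw [e2]
    refine (norm_add_le _ _).trans ((add_le_add i2 le_rfl).trans ?_)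
    rw [norm_mul, norm_pow, Complex.norm_real, Real.norm_eq_abs, abs_of_pos (by positivity)]
    have h1 : (q ^ 2) ^ 2 * ‖∫ s in δ * t..t, (X s + Y s)‖ ≤
        2 * (M + M') * K * (q * (η / δ)) := by
      calc _ ≤ (q ^ 2) ^ 2 * (2 * ((M + M') * (K / q ^ 2))) := by gcongr
        _ = 2 * (M + M') * K * (q * q) := by field_simp
        _ ≤ _ := by
          gcongr
          exact hqη.trans ((le_div_iff₀ hδ).2 (mul_le_of_le_one_right hη0.le hδ1))
    linarith
  rw [← intervalIntegral.integral_add_adjacent_intervals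
    (cJ.intervalIntegrable 0 (δ * t)) (cJ.intervalIntegrable (δ * t) t)]
  refine (norm_add_le _ _).trans ?_
  have i5 : ‖∫ s in δ * t..t, J s‖ ≤
      (2 * C + 2 * (M + M') * K) / |wedge v w| * (q * (η / δ)) := by
    rw [div_mul_eq_mul_div, le_div_iff₀' hN']
    exact i4
  have p1 : 0 ≤ (2 * C + 2 * (M + M') * K) / |wedge v w| := by positivity
  have p2 : 0 ≤ (2 * C + 2 * (M + M') * K) / |wedge v w| * (q * δ) := by positivity
  have p3 : 0 ≤ M * (q * (η / δ)) := by positivity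
  calc _ ≤ M * (q * δ) + (2 * C + 2 * (M + M') * K) / |wedge v w| * (q * (η / δ)) :=
        add_le_add i1 i5
    _ ≤ _ := by linarith

end IsQuasimode

end Averages

/-- The integral of the parallel transports of `f` along `v` over times in `[0, L]`. -/
noncomputable def sweep (P : Pt → Pt) (v : Pt) (L : ℝ) (f : Pt → ℂ) : Pt → ℂ := fun x =>
  ∫ s in (0 : ℝ)..L, transport P v s f x

section Sweep

variable {Φ : ℝ} {P : Pt → Pt} {B : Pt → ℝ} {v w : Pt}

theorem continuous_sweep (hP : IsMagneticPotential Φ P B) {f : Pt → ℂ} (hf : Continuous f)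
    (v : Pt) (L : ℝ) : Continuous (sweep P v L f) := by
  have h : Continuous (Function.uncurry fun (x : Pt) (s : ℝ) => transport P v s f x) := by
    have h1 := (continuous_transport hP hf v).comp (continuous_swap (X := Pt) (Y := ℝ))
    exact h1
  exact intervalIntegral.continuous_parametric_intervalIntegral_of_continuous' h 0 L

theorem ip_mul_sweep_sweep (hP : IsMagneticPotential Φ P B) {b : Pt → ℝ} (hb : Continuous b)
    {f : Pt → ℂ} (hf : Continuous f) (v : Pt) {L : ℝ} (hL : 0 ≤ L) :
    ip (fun x => (b x : ℂ) * sweep P v L f x) (sweep P v L f) =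
      ∫ t in (0 : ℝ)..L, ∫ s in (0 : ℝ)..L,
        corr P v (fun x => b x) f (transport P v t f) s := by
  have cb : Continuous fun x => (b x : ℂ) := Complex.continuous_ofReal.comp hb
  have cV := continuous_sweep hP hf v L
  have cT := fun s => (contDiff_transport (n := 0) hP (contDiff_zero.2 hf) v s).continuous
  have h1 : ∀ t, ∫ s in (0 : ℝ)..L, corr P v (fun x => b x) f (transport P v t f) s =
      conj (corr P v 1 f (fun x => (b x : ℂ) * sweep P v L f x) t) := fun t => by
    rw [integral_corr hP cb hf (cT t) v, corr, conj_ip]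
    simp [sweep]
  simp_rw [h1]
  rw [intervalIntegral.integral_of_le hL, integral_conj, ← intervalIntegral.integral_of_le hL,
    integral_corr hP continuous_one hf (g := fun x => (b x : ℂ) * sweep P v L f x) (cb.mul cV) v,
    conj_ip]
  simp only [Pi.one_apply, one_mul]
  rfl

theorem norm_integral_sub_le {J : ℝ → ℂ} (hJ : Continuous J) {q D : ℝ}
    (hD : ∀ t, |t| ≤ q → ‖∫ s in (0 : ℝ)..t, J s‖ ≤ D) {L t : ℝ} (ht : 0 ≤ t) (htL : t ≤ L)
    (hL : L ≤ q) : ‖∫ s in (0 : ℝ)..L, J (s - t)‖ ≤ 2 * D := by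
  rw [intervalIntegral.integral_comp_sub_right J t, zero_sub,
    ← intervalIntegral.integral_interval_sub_left (hJ.intervalIntegrable 0 _)
      (hJ.intervalIntegrable 0 _), two_mul]
  exact norm_sub_le_of_le (hD _ (by rw [abs_of_nonneg] <;> linarith))
    (hD _ (by rw [abs_neg, abs_of_nonneg] <;> linarith))

theorem IsQuasimode.exists_nrm_sweep_sq_le (hP : IsMagneticPotential Φ P B) (hN : wedge v w ≠ 0)
    {b g : Pt → ℝ} (hb : ContDiff ℝ 2 b) (hbp : IsPeriodic b) (hg : ContDiff ℝ 2 g)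
    (hgp : IsPeriodic g) (hbg : ∀ x, B x = b x + fderiv ℝ g x w) (hb0 : ∀ x, b x ≠ 0) :
    ∃ C, 0 ≤ C ∧ ∀ (q ρ : ℝ) (u : Pt → ℂ), 0 < q → q ≤ 1 → IsQuasimode Φ P v w (q ^ 2) ρ u →
      q + ρ / q ^ 3 ≤ 1 → ∀ L, 0 ≤ L → L ≤ q →
      nrm (sweep P v L u) ^ 2 ≤ C * q ^ 2 * √(q + ρ / q ^ 3) := by
  obtain ⟨C, hC, hCb⟩ := exists_norm_integral_corr_le hP hN hb hbp hg hgp hbg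
  obtain ⟨c, hc, hcb⟩ := exists_pos_le_or_le_neg hb.continuous hbp hb0
  obtain ⟨M, hM, hbM⟩ := (hbp.fderiv_apply v).exists_bound
    ((hb.continuous_fderiv two_ne_zero).clm_apply continuous_const)
  refine ⟨(4 * C + M) / c, by positivity, fun q ρ u hq hq1 hu hη1 L hL0 hL => ?_⟩
  have hρ := hu.error_nonneg
  have cu := hu.contDiff.continuous
  have hue := hu.equivariant
  have cb : Continuous fun x => (b x : ℂ) := Complex.continuous_ofReal.comp hb.continuous
  have hqη : q ≤ q + ρ / q ^ 3 := by linarith [show 0 ≤ ρ / q ^ 3 by positivity]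
  set η := q + ρ / q ^ 3
  have hη0 : 0 < η := by linarith
  have hs0 : 0 < √η := Real.sqrt_pos.2 hη0
  have hs1 : √η ≤ 1 := Real.sqrt_le_one.2 hη1
  have hηs : η ≤ √η := by nlinarith [Real.sq_sqrt hη0.le]
  set J := corr P v (fun x => b x) u u with hJ
  have cJ : Continuous J := continuous_corr hP cb cu cu v
  have hD : ∀ t, |t| ≤ q → ‖∫ s in (0 : ℝ)..t, J s‖ ≤ 2 * C * q * √η := fun t ht => by
    have h1 := hCb q ρ u hq hq1 hu _ hs0 hs1 t ht
    rw [Real.div_sqrt] at h1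
    linarith
  have hin : ∀ t, 0 ≤ t → t ≤ L →
      ‖∫ s in (0 : ℝ)..L, corr P v (fun x => b x) u (transport P v t u) s‖ ≤
        (4 * C + M) * q * √η := fun t ht htL => by
    have cd : Continuous fun x => ((b (x + (-t) • v) - b x : ℝ) : ℂ) :=
      Complex.continuous_ofReal.comp
        ((hb.continuous.comp (continuous_id.add continuous_const)).sub hb.continuous)
    have h1 : ∀ s, corr P v (fun x => b x) u (transport P v t u) s =
        J (s - t) + corr P v (fun x => ((b (x + (-t) • v) - b x : ℝ) : ℂ)) u u (s - t) :=
      fun s => by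
      rw [corr_transport_right hP cb hbp.ofReal cu hue cu hue, hJ]
      have := corr_add_mul hP cb cd cu cu 1 v (s - t)
      rw [one_mul] at this
      rw [← this]
      congr 1
      funext x
      push_cast
      ring
    have h2 : ∀ s, ‖corr P v (fun x => ((b (x + (-t) • v) - b x : ℝ) : ℂ)) u u s‖ ≤ M * t :=
      fun s => hu.norm_corr_self_le hP (by positivity) cd (fun x => by
        rw [Complex.norm_real]
        have := norm_integral_ray_sub_le (hb.of_le one_le_two) hbM x (-t)
        rwa [abs_neg, abs_of_nonneg ht] at this) s
    have cK := continuous_corr hP cd cu cu v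
    simp_rw [h1]
    rw [intervalIntegral.integral_add (Continuous.intervalIntegrable (by fun_prop) _ _)
      (Continuous.intervalIntegrable (by fun_prop) _ _)]
    have h3 := norm_integral_sub_le cJ hD ht htL hL
    have h4 := intervalIntegral.norm_integral_le_of_norm_le_const (a := 0) (b := L)
      fun s (_ : s ∈ Set.uIoc 0 L) => h2 (s - t)
    rw [sub_zero, abs_of_nonneg hL0] at h4
    have h5 : M * t * L ≤ M * (√η * q) := by
      rw [mul_assoc]
      have : t ≤ √η := by linarith
      gcongr
    refine (norm_add_le _ _).trans ?_
    linarith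
  have h1 := mul_nrm_sq_le_norm_ip hb.continuous hcb (continuous_sweep hP cu v L)
  rw [ip_mul_sweep_sweep hP hb.continuous cu v hL0] at h1
  have hin' : ∀ t ∈ Set.uIoc 0 L,
      ‖∫ s in (0 : ℝ)..L, corr P v (fun x => b x) u (transport P v t u) s‖ ≤
        (4 * C + M) * q * √η := fun t ht => by
    rw [Set.uIoc_of_le hL0] at ht
    exact hin t ht.1.le ht.2
  have h2 := intervalIntegral.norm_integral_le_of_norm_le_const hin'
  rw [sub_zero, abs_of_nonneg hL0] at h2
  have h3 : (4 * C + M) * q * √η * L ≤ (4 * C + M) * q * √η * q := by gcongr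
  rw [div_mul_eq_mul_div, div_mul_eq_mul_div, le_div_iff₀ hc]
  linarith

end Sweep

/-! ### Decay of the Fourier modes invariant under the flow -/

section FourierMode

variable {Φ : ℝ} {P : Pt → Pt} {B : Pt → ℝ} {v w : Pt}

theorem corr_const_mul (P : Pt → Pt) (v : Pt) (c : ℂ) (a f g : Pt → ℂ) (s : ℝ) :
    corr P v (fun x => c * a x) f g s = c * corr P v a f g s := by
  unfold corr
  rw [← ip_const_mul_left]
  simp only [mul_assoc]

theorem transport_zero (P : Pt → Pt) (v : Pt) (f : Pt → ℂ) : transport P v 0 f = f := by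
  funext x
  simp [transport, rayIntegral]

namespace IsQuasimode

theorem exists_norm_corr_covD_le (hP : IsMagneticPotential Φ P B) {e : Pt → ℂ}
    (he : ContDiff ℝ 2 e) (hep : IsPeriodic e) {κ : ℂ} (hκ : κ ≠ 0)
    (hev : ∀ x, fderiv ℝ e x v = κ * e x) (hew : ∀ x, fderiv ℝ e x w = 0) :
    ∃ C, 0 ≤ C ∧ ∀ (q ρ : ℝ) (u : Pt → ℂ), 0 < q → IsQuasimode Φ P v w (q ^ 2) ρ u →
      ∀ s, |s| ≤ 1 →
      ‖corr P v e (covD P v u) u s‖ ≤ C * ((q + ρ / q ^ 3) / q + |s| / q ^ 2) := by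
  obtain ⟨M, hM⟩ := exists_boundedSymbol hP he hep v w
  obtain ⟨M₁, hM₁, hB⟩ := hP.periodic.exists_bound (hP.contDiff_field 0).continuous
  have hM0 : 0 ≤ M := (norm_nonneg _).trans ((hM 0 (by simp)).norm_le 0)
  refine ⟨(M + M * (|wedge v w| * M₁) * (|wedge v w| + 1)) / ‖κ‖, by positivity,
    fun q ρ u hq hu s hs => ?_⟩
  have hκ0 : 0 < ‖κ‖ := norm_pos_iff.2 hκ
  have hρ := hu.error_nonneg
  have h1 := hu.norm_corr_add_corr_le hP hM0 (hM s hs)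
  have e1 : twistD B v v s e = fun x => (-Complex.I * κ) * e x := by
    funext x
    rw [twistD, twist_self, hev]
    push_cast
    ring
  have e2 : twistD B v w s e = fun x => e x * twist B v w s x := by
    funext x
    rw [twistD, hew, mul_zero, sub_zero]
  rw [e1, e2, corr_const_mul] at h1
  have c2 : Continuous fun x => e x * twist B v w s x :=
    he.continuous.mul (contDiff_twist hP 0 v w s).continuous
  have h2 : ‖corr P v (fun x => e x * twist B v w s x) (covD P w u) u s‖ ≤
      M * (|wedge v w| * (M₁ * |s|)) * ((|wedge v w| + 1) / q ^ 2) := by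
    have cY := (contDiff_covD (n := 2) (m := 1) hP hu.contDiff le_rfl w).continuous
    refine (norm_corr_le hP (M := M * (|wedge v w| * (M₁ * |s|))) (by positivity) c2
      (fun x => ?_) cY (hu.equivariant.covD hP hu.contDiff_one w)
      hu.contDiff.continuous v s).trans ?_
    · rw [norm_mul, Complex.norm_real]
      exact mul_le_mul ((hM s hs).norm_le x) (norm_twist_le hB v w s x) (norm_nonneg _) hM0
    · rw [hu.nrm_eq_one, mul_one]
      exact mul_le_mul_of_nonneg_left (hu.nrm_covD_right_le hP) (by positivity)
  set Y := corr P v (fun x => e x * twist B v w s x) (covD P w u) u s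
  set X := corr P v e (covD P v u) u s
  have h3 : ‖κ‖ * ‖X‖ ≤ ‖-Complex.I * κ * X + Y‖ + ‖Y‖ := by
    have := norm_sub_le (-Complex.I * κ * X + Y) Y
    rw [add_sub_cancel_right, norm_mul, norm_mul, norm_neg, Complex.norm_I, one_mul] at this
    exact this
  have h4 : ‖-Complex.I * κ * X + Y‖ ≤ M * ((q + ρ / q ^ 3) / q) := by
    have : M * ((q ^ 2) ^ 2 + ρ) = (q ^ 2) ^ 2 * (M * ((q + ρ / q ^ 3) / q)) := by
      field_simp
    rw [this] at h1
    exact le_of_mul_le_mul_left h1 (by positivity)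
  have p1 : 0 ≤ M * (|s| / q ^ 2) := by positivity
  have p2 : 0 ≤ M * (|wedge v w| * M₁) * (|wedge v w| + 1) * ((q + ρ / q ^ 3) / q) := by
    positivity
  have e3 : M * (|wedge v w| * (M₁ * |s|)) * ((|wedge v w| + 1) / q ^ 2) =
    M * (|wedge v w| * M₁) * (|wedge v w| + 1) * (|s| / q ^ 2) := by ring
  rw [div_mul_eq_mul_div, le_div_iff₀ hκ0]
  linarith

theorem exists_norm_ip_mul_le (hP : IsMagneticPotential Φ P B) (hN : wedge v w ≠ 0)
    {b g : Pt → ℝ} (hb : ContDiff ℝ 2 b) (hbp : IsPeriodic b) (hg : ContDiff ℝ 2 g)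
    (hgp : IsPeriodic g) (hbg : ∀ x, B x = b x + fderiv ℝ g x w) (hb0 : ∀ x, b x ≠ 0)
    {e : Pt → ℂ} (he : ContDiff ℝ 2 e) (hep : IsPeriodic e) {κ : ℂ} (hκ : κ ≠ 0)
    (hev : ∀ x, fderiv ℝ e x v = κ * e x) (hew : ∀ x, fderiv ℝ e x w = 0) :
    ∃ C, 0 ≤ C ∧ ∀ (q ρ : ℝ) (u : Pt → ℂ), 0 < q → q ≤ 1 → IsQuasimode Φ P v w (q ^ 2) ρ u →
      q + ρ / q ^ 3 ≤ 1 → ∀ ε, 0 < ε → ε ≤ 1 →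
      ‖ip (fun x => e x * u x) u‖ ≤
        C * (√√(q + ρ / q ^ 3) / ε + (q + ρ / q ^ 3) + ε ^ 2) := by
  obtain ⟨C₁, hC₁, h₁⟩ := exists_nrm_sweep_sq_le hP hN hb hbp hg hgp hbg hb0
  obtain ⟨C₂, hC₂, h₂⟩ := exists_norm_corr_covD_le hP he hep hκ hev hew
  obtain ⟨M, hM, heM⟩ := hep.exists_bound he.continuous
  refine ⟨M * √C₁ + C₂, by positivity, fun q ρ u hq hq1 hu hη1 ε hε hε1 => ?_⟩
  have hρ := hu.error_nonneg
  have cu := hu.contDiff.continuous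
  have h₁ := h₁ q ρ u hq hq1 hu hη1 (ε * q) (by positivity) (by nlinarith)
  have h₂ := h₂ q ρ u hq hu
  have hη0 : 0 < q + ρ / q ^ 3 := by positivity
  set η := q + ρ / q ^ 3
  set J := corr P v e u u with hJ
  have cJ : Continuous J := continuous_corr hP he.continuous cu cu v
  have hJ0 : J 0 = ip (fun x => e x * u x) u := by rw [hJ, corr, transport_zero]
  rw [← hJ0]
  have hdiff : ∀ s, 0 ≤ s → s ≤ ε * q → ‖J s - J 0‖ ≤ C₂ * (η + ε ^ 2) := fun s hs hsε => by
    have hεq : ε * q ≤ 1 := mul_le_one₀ hε1 hq.le hq1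
    have i1 := integral_corr_covD hP he.continuous hu.contDiff_one cu v 0 s
    have i2 : ‖∫ r in (0 : ℝ)..s, corr P v e (covD P v u) u r‖ ≤
        C₂ * (η / q + ε * q / q ^ 2) * |s - 0| := by
      refine intervalIntegral.norm_integral_le_of_norm_le_const fun r hr => ?_
      rw [Set.uIoc_of_le hs] at hr
      have hr' : |r| = r := abs_of_pos hr.1
      refine (h₂ r (by rw [hr']; linarith [hr.2])).trans ?_
      gcongr
      rw [hr']
      linarith [hr.2]
    rw [i1, norm_mul, norm_neg, Complex.norm_I, one_mul, sub_zero, abs_of_nonneg hs] at i2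
    calc _ ≤ C₂ * (η / q + ε * q / q ^ 2) * s := i2
      _ ≤ C₂ * (η / q + ε * q / q ^ 2) * (ε * q) := by gcongr
      _ = C₂ * (ε * η + ε ^ 2) := by field_simp
      _ ≤ C₂ * (η + ε ^ 2) := by
        gcongr
        exact mul_le_of_le_one_left hη0.le hε1
  have hV : nrm (sweep P v (ε * q) u) ≤ √C₁ * q * √√η := by
    refine (sq_le_sq₀ (nrm_nonneg _) (by positivity)).1 ?_
    rw [mul_pow, mul_pow, Real.sq_sqrt hC₁, Real.sq_sqrt (Real.sqrt_nonneg _)]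
    exact h₁
  have hI : ‖∫ s in (0 : ℝ)..ε * q, J s‖ ≤ M * (√C₁ * q * √√η) := by
    have cV := continuous_sweep hP cu v (ε * q)
    rw [integral_corr hP he.continuous cu cu v]
    have := norm_ip_le (he.continuous.mul cV) cu
    rw [hu.nrm_eq_one, mul_one] at this
    refine this.trans ((nrm_mul_le hM he.continuous cV heM).trans ?_)
    gcongr
  have hI' : ‖∫ s in (0 : ℝ)..ε * q, (J s - J 0)‖ ≤ C₂ * (η + ε ^ 2) * |ε * q - 0| :=
    intervalIntegral.norm_integral_le_of_norm_le_const fun s hs => by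
      rw [Set.uIoc_of_le (by positivity)] at hs
      exact hdiff s hs.1.le hs.2
  rw [sub_zero, abs_of_pos (by positivity)] at hI'
  have e1 : ((ε * q : ℝ) : ℂ) * J 0 =
      (∫ s in (0 : ℝ)..ε * q, J s) - ∫ s in (0 : ℝ)..ε * q, (J s - J 0) := by
    rw [intervalIntegral.integral_sub (cJ.intervalIntegrable _ _)
      (continuous_const.intervalIntegrable _ _)]
    simp
  have e2 := norm_sub_le_of_le hI hI'
  rw [← e1, norm_mul, Complex.norm_real, Real.norm_eq_abs, abs_of_pos (by positivity)] at e2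
  refine le_of_mul_le_mul_left (e2.trans ?_) (show 0 < ε * q by positivity)
  have p1 : 0 ≤ M * √C₁ * (ε * q) * (η + ε ^ 2) := by positivity
  have p2 : 0 ≤ C₂ * q * √√η := by positivity
  have e3 : ε * q * ((M * √C₁ + C₂) * (√√η / ε + η + ε ^ 2)) =
      M * (√C₁ * q * √√η) + C₂ * (η + ε ^ 2) * (ε * q) + M * √C₁ * (ε * q) * (η + ε ^ 2) +
        C₂ * q * √√η := by
    field_simp
    ring
  rw [e3]
  linarith

end IsQuasimode

end FourierMode

/-! ### The magnetic Laplacian along a rational direction -/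

theorem contDiff_A0 (B0 : ℝ) {n : WithTop ℕ∞} : ContDiff ℝ n (A0 B0) := by
  unfold A0
  fun_prop

theorem A0_add (B0 : ℝ) (x y : Pt) : A0 B0 (x + y) = A0 B0 x + A0 B0 y := by
  ext <;> simp [A0] <;> ring

theorem Pt.eq_smul_add_smul (v : Pt) : v = v.1 • ((1, 0) : Pt) + v.2 • ((0, 1) : Pt) := by
  ext <;> simp

theorem isMagneticPotential {B : Pt → ℝ} (hBsm : ContDiff ℝ (⊤ : ℕ∞) B) (hBper : IsPeriodic B)
    {B0 : ℝ} {Aper : Pt → Pt} (hApersm : ContDiff ℝ (⊤ : ℕ∞) Aper) (hAperper : IsPeriodic Aper)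
    {A : Pt → Pt} (hA : ∀ x, A x = A0 B0 x + Aper x)
    (hcurl : ∀ x, pdR1 (fun y => (A y).2) x - pdR2 (fun y => (A y).1) x = B x) (α : Pt) :
    IsMagneticPotential B0 (fun x => α + A x) B where
  smooth_field := hBsm
  periodic := hBper
  smooth_pot := by
    simp_rw [hA]
    exact contDiff_const.add ((contDiff_A0 B0).add hApersm)
  pot_add m x := by
    simp only [hA, A0_add, hAperper.add_intVec]
    abel
  curl x v w := by
    have hAd : Differentiable ℝ A := by
      have : ContDiff ℝ (⊤ : ℕ∞) A := by
        rw [funext hA]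
        exact (contDiff_A0 B0).add hApersm
      exact this.differentiable (by simp)
    have h1 := fderiv_dotp_comp (hAd x) (0, 1) (1, 0)
    have h2 := fderiv_dotp_comp (hAd x) (1, 0) (0, 1)
    have h3 := hcurl x
    simp only [dotp, one_mul, zero_mul, add_zero, zero_add] at h1 h2
    rw [pdR1, pdR2, h1, h2] at h3
    have h4 : fderiv ℝ (fun x => α + A x) x = fderiv ℝ A x := fderiv_const_add α
    rw [h4, ← h3]
    have hv := congrArg (fderiv ℝ A x) (Pt.eq_smul_add_smul v)
    have hw := congrArg (fderiv ℝ A x) (Pt.eq_smul_add_smul w)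
    rw [map_add, map_smul, map_smul] at hv hw
    simp only [hv, hw, dotp, wedge, Prod.fst_add, Prod.snd_add, Prod.smul_fst, Prod.smul_snd,
      smul_eq_mul]
    ring

theorem equivariant_of_magTrans {B0 : ℝ} {u : Pt → ℂ} (hu : ∀ m : ℤ × ℤ, magTrans B0 m u = u) :
    Equivariant B0 u := fun m x => by
  have h1 := congrFun (hu m) (x + intVec m)
  rw [← h1, magTrans]
  have h2 : wedge ((m.1 : ℝ), (m.2 : ℝ)) (x + intVec m) = wedge (intVec m) x := by
    simp [wedge, intVec]; ring
  have h3 : ((x + intVec m).1 - m.1, (x + intVec m).2 - m.2) = x := by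
    ext <;> simp [intVec]
  rw [h2, h3]
  congr 2
  push_cast
  ring

theorem covD_eq_Dop (α : Pt) (A : Pt → Pt) (v : Pt) (f : Pt → ℂ) (x : Pt) :
    covD (fun x => α + A x) v f x = v.1 * Dop1 α A f x + v.2 * Dop2 α A f x := by
  have h1 : covD (fun x => α + A x) (1, 0) f x = Dop1 α A f x := by
    simp [covD, Dop1, pd1, dotp]
  have h2 : covD (fun x => α + A x) (0, 1) f x = Dop2 α A f x := by
    simp [covD, Dop2, pd2, dotp]
  conv_lhs => rw [Pt.eq_smul_add_smul v]
  rw [covD_add_dir, covD_smul_dir, covD_smul_dir, h1, h2]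

theorem lapOp_eq_magLap {Φ : ℝ} {B : Pt → ℝ} {α : Pt} {A : Pt → Pt}
    (hP : IsMagneticPotential Φ (fun x => α + A x) B) {f : Pt → ℂ} (hf : ContDiff ℝ 2 f)
    (v : Pt) (h : ℝ) (x : Pt) :
    lapOp (fun x => α + A x) v (-v.2, v.1) (wedge v (-v.2, v.1)) h f x =
      (wedge v (-v.2, v.1) : ℂ) * (((h ^ 2 : ℝ) : ℂ) * magLap α A f x - f x) := by
  have d : ∀ v, Differentiable ℝ (covD (fun x => α + A x) v f) := fun v =>
    (contDiff_covD (n := 2) (m := 1) hP hf le_rfl v).differentiable one_ne_zero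
  have d1 : Differentiable ℝ (Dop1 α A f) := by
    have : Dop1 α A f = covD (fun x => α + A x) (1, 0) f := funext fun x => by
      simp [covD_eq_Dop]
    exact this ▸ d _
  have d2 : Differentiable ℝ (Dop2 α A f) := by
    have : Dop2 α A f = covD (fun x => α + A x) (0, 1) f := funext fun x => by
      simp [covD_eq_Dop]
    exact this ▸ d _
  have key : ∀ v : Pt, covD (fun x => α + A x) v (covD (fun x => α + A x) v f) x =
      v.1 * (v.1 * Dop1 α A (Dop1 α A f) x + v.2 * Dop2 α A (Dop1 α A f) x) +
      v.2 * (v.1 * Dop1 α A (Dop2 α A f) x + v.2 * Dop2 α A (Dop2 α A f) x) := fun v => by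
    rw [funext (covD_eq_Dop α A v f), covD_add ((d1 x).const_mul _) ((d2 x).const_mul _),
      covD_const_mul (d1 x), covD_const_mul (d2 x), covD_eq_Dop, covD_eq_Dop]
  rw [lapOp, key, key, magLap, wedge]
  push_cast
  ring

/-! ### Directional averages -/

theorem field_eq_average_add {B : Pt → ℝ} (hB : ContDiff ℝ 1 B) {w : Pt}
    (hw : ∀ x, B (x + w) = B x) (x : Pt) :
    B x = rayIntegral 1 B w 0 1 x + fderiv ℝ (rayIntegral id B w 0 1) x w := by
  rw [fderiv_rayIntegral contDiff_id hB]
  unfold rayIntegral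
  have c1 : Continuous fun t : ℝ => fderiv ℝ B (x + t • w) w :=
    ((hB.continuous_fderiv one_ne_zero).comp (by fun_prop)).clm_apply continuous_const
  have h := intervalIntegral.integral_mul_deriv_eq_deriv_mul (a := 0) (b := 1)
    (u := id) (u' := fun _ => 1) (v := fun t : ℝ => B (x + t • w))
    (fun t _ => hasDerivAt_id t) (fun t _ => hasDerivAt_comp_ray hB x w t)
    intervalIntegrable_const (c1.intervalIntegrable _ _)
  rw [h]
  simp [hw]

theorem integral_ray_nat_mul {B : Pt → ℝ} (hB : Continuous B) {w : Pt}
    (hw : ∀ x, B (x + w) = B x) (x : Pt) (n : ℕ) :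
    ∫ t in (0 : ℝ)..n, B (x + t • w) = n * rayIntegral 1 B w 0 1 x := by
  have hper : Function.Periodic (fun t : ℝ => B (x + t • w)) 1 := fun t => by
    beta_reduce
    rw [add_smul, one_smul, ← add_assoc, hw]
  have := hper.intervalIntegral_add_zsmul_eq n 0
    (fun _ _ => Continuous.intervalIntegrable (by fun_prop) _ _)
  simpa [rayIntegral] using this

theorem eq_rayIntegral_of_tendsto {B : Pt → ℝ} (hB : Continuous B) {w : Pt}
    (hw : ∀ x, B (x + w) = B x) {r : ℝ} (hr : 0 < r) {x : Pt} {l : ℝ}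
    (hl : Tendsto (fun T : ℝ => (1 / T) * ∫ t in (0 : ℝ)..T, B (x + t • r⁻¹ • w)) atTop (𝓝 l)) :
    l = rayIntegral 1 B w 0 1 x := by
  have h1 : Tendsto (fun n : ℕ => (n : ℝ) * r) atTop atTop :=
    tendsto_natCast_atTop_atTop.atTop_mul_const hr
  refine tendsto_nhds_unique (hl.comp h1) (tendsto_const_nhds.congr' ?_)
  filter_upwards [eventually_gt_atTop 0] with n hn
  have hn' : (0 : ℝ) < n := by exact_mod_cast hn
  have h2 := intervalIntegral.integral_comp_div (a := 0) (b := n * r)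
    (fun t => B (x + t • w)) hr.ne'
  simp only [Function.comp_apply, smul_smul, ← div_eq_mul_inv]
  rw [h2, zero_div, mul_div_cancel_right₀ _ hr.ne', integral_ray_nat_mul hB hw, smul_eq_mul]
  field_simp

/-! ### Characters of the torus -/

/-- The character `e^{-2iπ k·x}`. -/
noncomputable def torusChar (k : ℤ × ℤ) (x : Pt) : ℂ :=
  Complex.exp (-(2 * π * Complex.I) * (dotp (intVec k) x : ℝ))

theorem fourier_mul_fourier_proj2 (k : ℤ × ℤ) (x : Pt) :
    fourier (-k.1) (proj2 x).1 * fourier (-k.2) (proj2 x).2 = torusChar k x := by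
  rw [proj2, fourier_coe_apply, fourier_coe_apply, ← Complex.exp_add, torusChar]
  congr 1
  simp only [dotp, intVec]
  push_cast
  ring

theorem isPeriodic_torusChar (k : ℤ × ℤ) : IsPeriodic (torusChar k) := fun m x => by
  rw [← fourier_mul_fourier_proj2, ← fourier_mul_fourier_proj2]
  have : proj2 (x.1 + m.1, x.2 + m.2) = proj2 x := by
    simp [proj2]
  rw [this]

theorem contDiff_torusChar (k : ℤ × ℤ) {n : WithTop ℕ∞} : ContDiff ℝ n (torusChar k) := by
  unfold torusChar dotp
  have : ContDiff ℝ n fun x : Pt => ((intVec k).1 * x.1 + (intVec k).2 * x.2 : ℝ) := by fun_prop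
  exact (contDiff_const.mul (Complex.ofRealCLM.contDiff.comp this)).cexp

theorem fderiv_torusChar (k : ℤ × ℤ) (x v : Pt) :
    fderiv ℝ (torusChar k) x v =
      -(2 * π * Complex.I) * (dotp (intVec k) v : ℝ) * torusChar k x := by
  have h := hasDerivAt_comp_ray (contDiff_torusChar k (n := 1)) x v 0
  rw [zero_smul, add_zero] at h
  have h1 : ∀ t : ℝ, dotp (intVec k) (x + t • v) = dotp (intVec k) x + t * dotp (intVec k) v :=
    fun t => by simp [dotp]; ring
  have h2 : HasDerivAt (fun t : ℝ => dotp (intVec k) (x + t • v)) (dotp (intVec k) v) 0 := by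
    simp_rw [h1]
    simpa using ((hasDerivAt_id (0 : ℝ)).mul_const (dotp (intVec k) v)).const_add
      (dotp (intVec k) x)
  have h3 := ((h2.ofReal_comp).const_mul (-(2 * π * Complex.I))).cexp
  rw [h.unique h3, zero_smul, add_zero, torusChar]
  ring

theorem nrm_lapOp_eq {Φ : ℝ} {B : Pt → ℝ} {α : Pt} {A : Pt → Pt}
    (hP : IsMagneticPotential Φ (fun x => α + A x) B) {f : Pt → ℂ} (hf : ContDiff ℝ 2 f)
    (v : Pt) (h : ℝ) :
    nrm (lapOp (fun x => α + A x) v (-v.2, v.1) (wedge v (-v.2, v.1)) h f) =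
      |wedge v (-v.2, v.1)| *
        (∫ x in fund, ‖((h ^ 2 : ℝ) : ℂ) * magLap α A f x - f x‖ ^ 2) ^ ((1 : ℝ) / 2) := by
  rw [nrm, funext (lapOp_eq_magLap hP hf v h), ← Real.sqrt_eq_rpow, ← Real.sqrt_sq_eq_abs,
    ← Real.sqrt_mul (sq_nonneg _), ← integral_const_mul]
  simp only [norm_mul, mul_pow, Complex.norm_real, Real.norm_eq_abs, sq_abs]

theorem ip_mul_self (e u : Pt → ℂ) :
    ip (fun x => e x * u x) u = ∫ x in fund, e x * ((‖u x‖ ^ 2 : ℝ) : ℂ) := by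
  unfold ip
  simp [mul_assoc, Complex.mul_conj, Complex.normSq_eq_norm_sq]

/-- third item of Theorem A.1: if a quantum limit `ν` has a nonzero
Fourier coefficient `ν̂_k`, `k ≠ 0`, then `B_∞` vanishes somewhere in a direction
orthogonal to `k`. -/
theorem statement17
    (B : Pt → ℝ) (hBsm : ContDiff ℝ (⊤ : ℕ∞) B) (hBper : IsPeriodic B)
    (B0 : ℝ) (hB0 : B0 = ∫ x in fund, B x) (hflux : ∃ k : ℤ, B0 = 2 * π * k)
    (hB0pos : 0 < B0)
    (Aper : Pt → Pt) (hApersm : ContDiff ℝ (⊤ : ℕ∞) Aper) (hAperper : IsPeriodic Aper)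
    (A : Pt → Pt) (hA : ∀ x, A x = A0 B0 x + Aper x)
    (hcurl : ∀ x, pdR1 (fun y => (A y).2) x - pdR2 (fun y => (A y).1) x = B x)
    (Binf : Pt → Pt → ℝ)
    (hBinf : ∀ x θ : Pt, Tendsto (fun T : ℝ => (1 / T) * ∫ t in (0:ℝ)..T, B (x + t • θ))
      atTop (𝓝 (Binf x θ)))
    (α : Pt) (ν : Measure T2) (hν : IsQuantumLimit B0 α A ν)
    (k : ℤ × ℤ) (hk : k ≠ 0)
    (hνk : (∫ p : T2, (fourier (-k.1) p.1 * fourier (-k.2) p.2) ∂ν) ≠ 0) :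
    ∃ (x₀ θ : Pt), θ.1 ^ 2 + θ.2 ^ 2 = 1 ∧ (k.1 : ℝ) * θ.1 + (k.2 : ℝ) * θ.2 = 0 ∧
      Binf x₀ θ = 0 := by
  by_contra! hB
  obtain ⟨-, h, u, hpos, hlim, hC2, hmag, hnorm, herr, hweak⟩ := hν
  have hP := isMagneticPotential hBsm hBper hApersm hAperper hA hcurl α
  set v := intVec k with hv
  set w : Pt := (-v.2, v.1) with hw
  set P : Pt → Pt := fun x => α + A x
  have hwv : wedge v w = v.1 ^ 2 + v.2 ^ 2 := by simp [wedge, hw]; ring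
  have hN : 0 < wedge v w := by
    rw [hwv]
    have : v.1 ≠ 0 ∨ v.2 ≠ 0 := by
      by_contra! hv0
      exact hk (Prod.ext (by simpa [hv, intVec] using hv0.1) (by simpa [hv, intVec] using hv0.2))
    rcases this with h | h <;> positivity
  have hBw : ∀ x, B (x + w) = B x := fun x => by
    have := hBper.add_intVec (-k.2, k.1) x
    rwa [show intVec (-k.2, k.1) = w by simp [hw, hv, intVec]] at this
  have hb0 : ∀ x, rayIntegral 1 B w 0 1 x ≠ 0 := fun x => by
    have hr : 0 < √(wedge v w) := Real.sqrt_pos.2 hN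
    have hr2 : √(wedge v w) ^ 2 = v.1 ^ 2 + v.2 ^ 2 := by rw [Real.sq_sqrt hN.le, hwv]
    rw [← eq_rayIntegral_of_tendsto hBsm.continuous hBw hr (hBinf x _)]
    set r := √(wedge v w)
    refine hB x _ ?_ ?_
    · simp only [hw, Prod.smul_fst, Prod.smul_snd, smul_eq_mul]
      field_simp
      linarith
    · simp only [hw, hv, intVec, Prod.smul_fst, Prod.smul_snd, smul_eq_mul]
      ring
  have hκ : -(2 * π * Complex.I) * (dotp v v : ℝ) ≠ 0 := by
    have : dotp v v ≠ 0 := by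
      rw [dotp, ← sq, ← sq, ← hwv]
      exact hN.ne'
    have hπ := Complex.ofReal_ne_zero.2 Real.pi_ne_zero
    simp [this, hπ]
  have hvw : dotp v w = 0 := by simp [dotp, hw]; ring
  obtain ⟨C, -, hC⟩ := IsQuasimode.exists_norm_ip_mul_le hP hN.ne'
    (ContDiff.rayIntegral (n := 2) contDiff_const (hP.contDiff_field 2) w 0 1)
    (hBper.rayIntegral 1 w 0 1)
    (ContDiff.rayIntegral (n := 2) contDiff_id (hP.contDiff_field 2) w 0 1)
    (hBper.rayIntegral id w 0 1) (field_eq_average_add (hP.contDiff_field 1) hBw) hb0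
    (contDiff_torusChar k) (isPeriodic_torusChar k) hκ (fun x => fderiv_torusChar k x v)
    (fun x => by rw [fderiv_torusChar, ← hv, hvw]; simp)
  set ρ := fun n => nrm (lapOp P v w (wedge v w) (h n) (u n)) with hρ
  have hq : Tendsto (fun n => √(h n)) atTop (𝓝 0) := by
    simpa using hlim.sqrt
  have hρq : Tendsto (fun n => ρ n / √(h n) ^ 3) atTop (𝓝 0) := by
    have h1 := herr.tendsto_div_nhds_zero.const_mul |wedge v w|
    rw [mul_zero] at h1
    refine h1.congr fun n => ?_
    rw [hρ]
    beta_reduce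
    rw [nrm_lapOp_eq hP (hC2 n), mul_div_assoc, Real.sqrt_eq_rpow,
      ← Real.rpow_mul_natCast (hpos n).le]
    norm_num [hw]
  have hη := hq.add hρq
  rw [add_zero] at hη
  have hρ0 : Tendsto ρ atTop (𝓝 0) := by
    have h1 := hρq.mul (hq.pow 3)
    rw [zero_mul] at h1
    refine h1.congr fun n => div_mul_cancel₀ _ ?_
    have := Real.sqrt_pos.2 (hpos n)
    positivity
  have hwk := hweak (fun p => fourier (-k.1) p.1 * fourier (-k.2) p.2) (by fun_prop)
  simp only [fourier_mul_fourier_proj2, ← ip_mul_self] at hwk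
  have hε : ∀ ε : ℝ, 0 < ε → ε ≤ 1 →
      ‖∫ p : T2, (fourier (-k.1) p.1 * fourier (-k.2) p.2) ∂ν‖ ≤ C * ε ^ 2 := fun ε hε hε1 => by
    have h1 : Tendsto (fun n => C * (√√(√(h n) + ρ n / √(h n) ^ 3) / ε +
        (√(h n) + ρ n / √(h n) ^ 3) + ε ^ 2)) atTop (𝓝 (C * ε ^ 2)) := by
      have := (((hη.sqrt.sqrt.div_const ε).add hη).add_const (ε ^ 2)).const_mul C
      simpa using this
    refine le_of_tendsto_of_tendsto hwk.norm h1 ?_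
    filter_upwards [hlim.eventually_le_const one_pos, hη.eventually_le_const one_pos,
      hρ0.eventually_le_const one_pos] with n hn1 hn2 hn3
    have hq0 := Real.sqrt_pos.2 (hpos n)
    refine hC (√(h n)) (ρ n) (u n) hq0 (Real.sqrt_le_one.2 hn1) ?_ hn2 ε hε hε1
    rw [Real.sq_sqrt (hpos n).le]
    exact ⟨hC2 n, equivariant_of_magTrans (hmag n), by rw [nrm, hnorm, Real.sqrt_one], hpos n,
      hn1, hn3, le_rfl⟩
  have h0 : Tendsto (fun ε : ℝ => C * ε ^ 2) (𝓝[>] 0) (𝓝 0) := by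
    have : Tendsto (fun ε : ℝ => C * ε ^ 2) (𝓝 0) (𝓝 (C * 0 ^ 2)) :=
      Continuous.tendsto (by fun_prop) 0
    simpa using this.mono_left nhdsWithin_le_nhds
  have hle : ‖∫ p : T2, (fourier (-k.1) p.1 * fourier (-k.2) p.2) ∂ν‖ ≤ 0 := by
    refine ge_of_tendsto h0 ?_
    filter_upwards [Ioc_mem_nhdsGT one_pos] with ε hε'
    exact hε ε hε'.1 hε'.2
  exact hνk (norm_le_zero_iff.1 hle)
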